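/- arXiv:1509.05501 — 2 statements merged into one kernel-verified Lean document; each statement's English description precedes it below -/
import Mathlib

section
/- For every integer n ≥ 2, |μ(A ∩ T^{-n}A)/μ(A) − μ(A)| ≤ (1/2^{n+2}) log(3/2), where A = [1/2,1), T is the Gauss map, and μ is the Gauss measure. -/
open MeasureTheory Filter Set

/-- The Gauss map `x ↦ 1/x - ⌊1/x⌋` (sending `0` to `0`). -/
noncomputable def gaussMap (x : ℝ) : ℝ := Int.fract x⁻¹

/-- The Gauss measure `μ(B) = (1/log 2) ∫_B dx/(1+x)` on `[0,1)`. -/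
noncomputable def gaussMeasure : Measure ℝ :=
  (volume.restrict (Set.Ico (0:ℝ) 1)).withDensity
    (fun x => ENNReal.ofReal (1 / ((1 + x) * Real.log 2)))

/-- The `n`-th continued fraction digit `a_{n+1}` of `x`. -/
noncomputable def cfDigit (x : ℝ) (n : ℕ) : ℤ := ⌊(gaussMap^[n] x)⁻¹⌋

/-- The cylinder set of points of `[0,1)` whose continued fraction expansion starts with `s`. -/
noncomputable def cylinder (s : List ℕ+) : Set ℝ :=
  {x ∈ Set.Ico (0:ℝ) 1 | ∀ i (h : i < s.length), cfDigit x i = (s.get ⟨i, h⟩ : ℕ)}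

/-- A point of `[0,1)` is CF-normal if every finite string of positive integers occurs among
its continued fraction digits with limiting frequency equal to the Gauss measure of the
corresponding cylinder set. -/
noncomputable def CFNormal (x : ℝ) : Prop :=
  ∀ s : List ℕ+, s ≠ [] →
    Filter.Tendsto
      (fun n : ℕ => (Nat.card {i : ℕ | i ≤ n ∧ gaussMap^[i] x ∈ cylinder s} : ℝ) / n)
      Filter.atTop (nhds (gaussMeasure (cylinder s)).toReal)

/-- The Gauss–Kuzmin transfer operator. -/
noncomputable def transferOp (f : ℝ → ℝ) (x : ℝ) : ℝ :=
  ∑' k : ℕ, (1 + x) / (((k:ℝ) + 1 + x) * ((k:ℝ) + 2 + x)) * f (1 / ((k:ℝ) + 1 + x))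

/-- Wirsing's operator. -/
noncomputable def wirsingOp (g : ℝ → ℝ) (x : ℝ) : ℝ :=
  ∑' k : ℕ,
    (((k:ℝ) + 1) / (((k:ℝ) + 2 + x) ^ 2) *
        (∫ y in (1 / ((k:ℝ) + 2 + x))..(1 / ((k:ℝ) + 1 + x)), g y) +
      (1 + x) / (((k:ℝ) + 1 + x) ^ 3 * ((k:ℝ) + 2 + x)) * g (1 / ((k:ℝ) + 1 + x)))


noncomputable def pw (k : ℕ) (x : ℝ) : ℝ := (1 + x) / (((k:ℝ) + 1 + x) * ((k:ℝ) + 2 + x))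

noncomputable def PE (F : ℝ → ENNReal) (x : ℝ) : ENNReal :=
  ∑' k : ℕ, ENNReal.ofReal (pw k x) * F (1 / ((k:ℝ) + 1 + x))

noncomputable def gw (x : ℝ) : ℝ := 1 / ((1 + x) * Real.log 2)

lemma measurable_gw : Measurable gw := by unfold gw; fun_prop

lemma measurable_pw (k : ℕ) : Measurable (pw k) := by unfold pw; fun_prop

lemma measurable_gaussMap : Measurable gaussMap := by
  unfold gaussMap; exact measurable_fract.comp measurable_inv

lemma measurable_PE {F : ℝ → ENNReal} (hF : Measurable F) : Measurable (PE F) := by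
  unfold PE
  refine Measurable.tsum fun k => ?_
  refine (measurable_pw k).ennreal_ofReal.mul (hF.comp ?_)
  fun_prop

lemma gint {H : ℝ → ENNReal} (hH : Measurable H) :
    ∫⁻ x, H x ∂gaussMeasure = ∫⁻ x in Ico (0:ℝ) 1, ENNReal.ofReal (gw x) * H x := by
  change ∫⁻ x, H x ∂((volume.restrict (Ico (0:ℝ) 1)).withDensity (fun x => ENNReal.ofReal (gw x))) = _
  rw [lintegral_withDensity_eq_lintegral_mul _ (measurable_gw.ennreal_ofReal) hH]
  rfl

lemma Ioc_eq_iUnion : Ioc (0:ℝ) 1 = ⋃ k : ℕ, (fun y : ℝ => 1 / ((k:ℝ) + 1 + y)) '' Ico (0:ℝ) 1 := by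
  ext x
  simp only [mem_iUnion, mem_image, mem_Ioc, mem_Ico]
  constructor
  · rintro ⟨h0, h1⟩
    have h2 : 1 ≤ 1 / x := by rw [le_div_iff₀ h0]; linarith
    have h3 : 1 ≤ ⌊1 / x⌋₊ := Nat.le_floor (by simpa using h2)
    refine ⟨⌊1 / x⌋₊ - 1, 1 / x - ⌊1 / x⌋₊, ⟨?_, ?_⟩, ?_⟩
    · linarith [Nat.floor_le (show 0 ≤ 1 / x by positivity)]
    · linarith [Nat.lt_floor_add_one (1 / x)]
    · rw [Nat.cast_sub h3]; simp
  · rintro ⟨k, y, ⟨h0, h1⟩, rfl⟩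
    have : (0:ℝ) ≤ k := Nat.cast_nonneg k
    refine ⟨by positivity, ?_⟩
    rw [div_le_one (by positivity)]; linarith

lemma duality {F g : ℝ → ENNReal} (hF : Measurable F) (hg : Measurable g) :
    ∫⁻ x, F x * g (gaussMap x) ∂gaussMeasure = ∫⁻ x, PE F x * g x ∂gaussMeasure := by
  rw [gint (H := fun x => F x * g (gaussMap x)) (hF.mul (hg.comp measurable_gaussMap)),
    gint (H := fun x => PE F x * g x) ((measurable_PE hF).mul hg)]
  rw [setLIntegral_congr (Ico_ae_eq_Ioc (μ := volume)), Ioc_eq_iUnion]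
  have hder : ∀ k : ℕ, ∀ y ∈ Ico (0:ℝ) 1,
      HasDerivWithinAt (fun y : ℝ => 1 / ((k:ℝ) + 1 + y)) (-1 / ((k:ℝ) + 1 + y) ^ 2) (Ico 0 1) y := by
    intro k y hy
    have h0 : (k:ℝ) + 1 + y ≠ 0 := by
      have : (0:ℝ) ≤ k := Nat.cast_nonneg k
      have := hy.1
      positivity
    have := ((hasDerivAt_id y).const_add ((k:ℝ) + 1)).inv h0
    simpa [Pi.inv_def] using this.hasDerivWithinAt
  have hinj : ∀ k : ℕ, InjOn (fun y : ℝ => 1 / ((k:ℝ) + 1 + y)) (Ico (0:ℝ) 1) := by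
    intro k y hy z hz h
    simp only [one_div, inv_inj] at h
    linarith
  rw [lintegral_iUnion]
  · have : ∀ k : ℕ, ∫⁻ x in (fun y : ℝ => 1 / ((k:ℝ) + 1 + y)) '' Ico (0:ℝ) 1,
        ENNReal.ofReal (gw x) * (F x * g (gaussMap x)) =
        ∫⁻ y in Ico (0:ℝ) 1, ENNReal.ofReal (gw y) * (ENNReal.ofReal (pw k y) * F (1 / ((k:ℝ) + 1 + y)) * g y) := by
      intro k
      rw [lintegral_image_eq_lintegral_abs_deriv_mul measurableSet_Ico (hder k) (hinj k)]
      refine setLIntegral_congr_fun measurableSet_Ico fun y hy => ?_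
      have hk : (0:ℝ) ≤ k := Nat.cast_nonneg k
      have hy0 := hy.1
      have hT : gaussMap (1 / ((k:ℝ) + 1 + y)) = y := by
        unfold gaussMap
        rw [one_div, inv_inv, Int.fract_eq_iff]
        refine ⟨hy.1, hy.2, (k:ℤ) + 1, ?_⟩
        push_cast; ring
      simp only [hT]
      rw [← mul_assoc, ← mul_assoc, ← mul_assoc, ← mul_assoc, ← ENNReal.ofReal_mul (abs_nonneg _),
        ← ENNReal.ofReal_mul]
      · congr 3
        have hl := Real.log_pos (one_lt_two)
        unfold gw pw
        rw [abs_div, abs_neg, abs_one, abs_of_pos (by positivity)]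
        field_simp
        ring
      · have hl := Real.log_pos (one_lt_two)
        unfold gw; positivity
    simp_rw [this]
    rw [← lintegral_tsum]
    · refine lintegral_congr fun y => ?_
      rw [ENNReal.tsum_mul_left, ENNReal.tsum_mul_right]; rfl
    · intro k
      refine Measurable.aemeasurable ?_
      refine measurable_gw.ennreal_ofReal.mul ((((measurable_pw k).ennreal_ofReal).mul (hF.comp ?_)).mul hg)
      fun_prop
  · intro k
    exact measurableSet_Ico.image_of_continuousOn_injOn (fun y hy => (hder k y hy).continuousWithinAt) (hinj k)
  · intro j k hjk
    refine Set.disjoint_left.2 ?_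
    rintro _ ⟨y, hy, rfl⟩ ⟨z, hz, h⟩
    simp only [one_div, inv_inj] at h
    apply hjk
    have h1 : (j:ℝ) < k + 1 := by linarith [hy.1, hz.2]
    have h2 : (k:ℝ) < j + 1 := by linarith [hy.2, hz.1]
    have h1' : j < k + 1 := by exact_mod_cast h1
    have h2' : k < j + 1 := by exact_mod_cast h2
    omega

lemma duality_iter {g : ℝ → ENNReal} (hg : Measurable g) (n : ℕ) :
    ∀ {F : ℝ → ENNReal}, Measurable F →
    ∫⁻ x, F x * g (gaussMap^[n] x) ∂gaussMeasure = ∫⁻ x, PE^[n] F x * g x ∂gaussMeasure := by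
  induction n with
  | zero => intro F hF; rfl
  | succ n ih =>
    intro F hF
    have := duality (g := fun x => g (gaussMap^[n] x)) hF (hg.comp (measurable_gaussMap.iterate n))
    simp only [Function.iterate_succ, Function.comp_apply] at this ⊢
    rw [this, ih (measurable_PE hF)]

lemma mem_branch {x : ℝ} (hx : x ∈ Ioc (0:ℝ) 1) (k : ℕ) : 1 / ((k:ℝ) + 1 + x) ∈ Ioc (0:ℝ) 1 := by
  have hk : (0:ℝ) ≤ k := Nat.cast_nonneg k
  have := hx.1
  refine ⟨by positivity, ?_⟩
  rw [div_le_one (by positivity)]; linarith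

lemma pw_nonneg {x : ℝ} (hx : 0 < x) (k : ℕ) : 0 ≤ pw k x := by unfold pw; positivity

lemma pw_partial {x : ℝ} (hx : 0 < x) (N : ℕ) :
    ∑ k ∈ Finset.range N, pw k x = 1 - (1 + x) / ((N:ℝ) + 1 + x) := by
  induction N with
  | zero => simp; field_simp; simp
  | succ n ih =>
    rw [Finset.sum_range_succ, ih]; unfold pw; push_cast; field_simp; ring

lemma tendsto_aux (x : ℝ) : Tendsto (fun N : ℕ => (N:ℝ) + 1 + x) atTop atTop :=
  tendsto_atTop_add_const_right _ _ (tendsto_atTop_add_const_right _ _ tendsto_natCast_atTop_atTop)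

lemma hasSum_pw {x : ℝ} (hx : 0 < x) : HasSum (fun k => pw k x) 1 := by
  rw [hasSum_iff_tendsto_nat_of_nonneg (fun k => pw_nonneg hx k)]
  simp_rw [pw_partial hx]
  simpa using ((tendsto_aux x).const_div_atTop (1 + x)).const_sub 1

def Bd (C : ℝ) (h : ℝ → ℝ) : Prop := ∀ z ∈ Ioc (0:ℝ) 1, |h z| ≤ C

lemma summ {C : ℝ} {h : ℝ → ℝ} (hb : Bd C h) {x : ℝ} (hx : x ∈ Ioc (0:ℝ) 1) :
    Summable (fun k : ℕ => pw k x * h (1 / ((k:ℝ) + 1 + x))) := by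
  refine Summable.of_norm_bounded ((hasSum_pw hx.1).summable.mul_right C) fun k => ?_
  rw [Real.norm_eq_abs, abs_mul, abs_of_nonneg (pw_nonneg hx.1 k)]
  exact mul_le_mul_of_nonneg_left (hb _ (mem_branch hx k)) (pw_nonneg hx.1 k)

lemma tO_eq (h : ℝ → ℝ) (x : ℝ) :
    transferOp h x = ∑' k : ℕ, pw k x * h (1 / ((k:ℝ) + 1 + x)) := rfl

lemma tO_bd {C : ℝ} {h : ℝ → ℝ} (hb : Bd C h) : Bd C (transferOp h) := by
  intro x hx
  rw [tO_eq, ← Real.norm_eq_abs]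
  refine tsum_of_norm_bounded (g := fun k => pw k x * C) (by simpa using (hasSum_pw hx.1).mul_right C) fun k => ?_
  rw [Real.norm_eq_abs, abs_mul, abs_of_nonneg (pw_nonneg hx.1 k)]
  exact mul_le_mul_of_nonneg_left (hb _ (mem_branch hx k)) (pw_nonneg hx.1 k)

lemma tO_congr {h g : ℝ → ℝ} (hg : EqOn h g (Ioc 0 1)) : EqOn (transferOp h) (transferOp g) (Ioc 0 1) := by
  intro x hx
  rw [tO_eq, tO_eq]
  exact tsum_congr fun k => by rw [hg (mem_branch hx k)]

lemma tO_smul (c : ℝ) (h : ℝ → ℝ) (x : ℝ) : transferOp (fun y => c * h y) x = c * transferOp h x := by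
  rw [tO_eq, tO_eq, ← tsum_mul_left]
  exact tsum_congr fun k => by ring

lemma tO_add {C D : ℝ} {h g : ℝ → ℝ} (hb : Bd C h) (gb : Bd D g) {x : ℝ} (hx : x ∈ Ioc (0:ℝ) 1) :
    transferOp (fun y => h y + g y) x = transferOp h x + transferOp g x := by
  rw [tO_eq, tO_eq, tO_eq, ← (summ hb hx).tsum_add (summ gb hx)]
  exact tsum_congr fun k => by ring

lemma abel (c a : ℕ → ℝ) (hc : ∀ N, 0 ≤ ∑ k ∈ Finset.range N, c k) (ha : Antitone a) (N : ℕ) :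
    (∑ k ∈ Finset.range (N + 1), c k) * a N ≤ ∑ k ∈ Finset.range (N + 1), c k * a k := by
  induction N with
  | zero => simp
  | succ n ih =>
    rw [Finset.sum_range_succ, Finset.sum_range_succ _ (n + 1), add_mul]
    have := mul_le_mul_of_nonneg_left (ha (Nat.le_succ n)) (hc (n + 1))
    simp only [Nat.succ_eq_add_one] at this
    linarith

lemma tO_anti {C : ℝ} {h : ℝ → ℝ} (hb : Bd C h) (hm : MonotoneOn h (Ioc 0 1)) :
    AntitoneOn (transferOp h) (Ioc 0 1) := by
  intro x hx y hy hxy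
  have hx0 := hx.1
  have hy0 := hy.1
  have s1 : Summable (fun k : ℕ => pw k y * h (1 / ((k:ℝ) + 1 + x))) := by
    refine Summable.of_norm_bounded ((hasSum_pw hy.1).summable.mul_right C) fun k => ?_
    rw [Real.norm_eq_abs, abs_mul, abs_of_nonneg (pw_nonneg hy.1 k)]
    exact mul_le_mul_of_nonneg_left (hb _ (mem_branch hx k)) (pw_nonneg hy.1 k)
  rw [tO_eq, tO_eq]
  have e1 : ∑' k : ℕ, pw k y * h (1 / ((k:ℝ) + 1 + y)) ≤ ∑' k : ℕ, pw k y * h (1 / ((k:ℝ) + 1 + x)) := by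
    refine (summ hb hy).tsum_le_tsum (fun k => ?_) s1
    refine mul_le_mul_of_nonneg_left (hm (mem_branch hy k) (mem_branch hx k) ?_) (pw_nonneg hy.1 k)
    gcongr
  refine e1.trans ?_
  have sx := summ hb hx
  have H := (sx.sub s1).hasSum.tendsto_sum_nat
  rw [sx.tsum_sub s1] at H
  rw [← sub_nonneg]
  have hcs : ∀ N : ℕ, ∑ k ∈ Finset.range N, (pw k x - pw k y) =
      (1 + y) / ((N:ℝ) + 1 + y) - (1 + x) / ((N:ℝ) + 1 + x) := by
    intro N
    rw [Finset.sum_sub_distrib, pw_partial hx0, pw_partial hy0]; ring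
  have hc : ∀ N : ℕ, 0 ≤ ∑ k ∈ Finset.range N, (pw k x - pw k y) := by
    intro N
    rw [hcs, sub_nonneg, div_le_div_iff₀ (by positivity) (by positivity)]
    have : (0:ℝ) ≤ N := Nat.cast_nonneg N
    nlinarith
  have ha : Antitone (fun k : ℕ => h (1 / ((k:ℝ) + 1 + x))) := by
    intro j k hjk
    refine hm (mem_branch hx k) (mem_branch hx j) ?_
    have : (j:ℝ) ≤ k := by exact_mod_cast hjk
    gcongr
  have H2 : Tendsto (fun N : ℕ => -(C * ∑ k ∈ Finset.range N, (pw k x - pw k y))) atTop (nhds 0) := by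
    simp_rw [hcs]
    simpa using (((((tendsto_aux y).const_div_atTop (1 + y)).sub
      ((tendsto_aux x).const_div_atTop (1 + x)))).const_mul C).neg
  refine le_of_tendsto_of_tendsto ((tendsto_add_atTop_iff_nat 1).2 H2) ((tendsto_add_atTop_iff_nat 1).2 H)
    (Eventually.of_forall fun N => ?_)
  have := abel _ _ hc ha N
  simp only [sub_mul] at this
  refine le_trans ?_ this
  have h3 := (abs_le.1 (hb _ (mem_branch hx N))).1
  nlinarith [hc (N + 1)]

lemma iter_bd {C : ℝ} {h : ℝ → ℝ} (hb : Bd C h) (n : ℕ) : Bd C (transferOp^[n] h) := by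
  induction n with
  | zero => exact hb
  | succ n ih => rw [Function.iterate_succ_apply']; exact tO_bd ih

lemma iter_mono {C : ℝ} {h : ℝ → ℝ} (hb : Bd C h) (hm : MonotoneOn h (Ioc 0 1)) (n : ℕ) :
    MonotoneOn (fun x => (-1) ^ n * transferOp^[n] h x) (Ioc 0 1) := by
  induction n with
  | zero => simpa using hm
  | succ n ih =>
    have hb' : Bd C (fun x => (-1) ^ n * transferOp^[n] h x) := by
      intro z hz
      rw [abs_mul]; simpa using iter_bd hb n z hz
    have := tO_anti hb' ih
    intro x hx y hy hxy
    have := this hx hy hxy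
    rw [tO_smul, tO_smul] at this
    simp only [Function.iterate_succ_apply', pow_succ]
    linarith

noncomputable def h0 (y : ℝ) : ℝ := 2 * y / (1 + 2 * y)

noncomputable def Fr (n : ℕ) : ℝ → ℝ := transferOp^[n] h0

lemma Fr_succ (n : ℕ) : Fr (n + 1) = transferOp (Fr n) := Function.iterate_succ_apply' _ _ _

lemma h0_bd : Bd 1 h0 := by
  intro z hz
  have := hz.1
  unfold h0
  rw [abs_of_nonneg (by positivity), div_le_one (by positivity)]; linarith

lemma Fr_bd (n : ℕ) : Bd 1 (Fr n) := iter_bd h0_bd n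

lemma h0_mono : MonotoneOn h0 (Ioc 0 1) := by
  intro x hx y hy hxy
  have := hx.1
  have := hy.1
  unfold h0
  rw [div_le_div_iff₀ (by positivity) (by positivity)]
  nlinarith

lemma Fr_nonneg (n : ℕ) : ∀ x ∈ Ioc (0:ℝ) 1, 0 ≤ Fr n x := by
  induction n with
  | zero => intro x hx; have := hx.1; change 0 ≤ h0 x; unfold h0; positivity
  | succ n ih =>
    intro x hx
    rw [Fr_succ, tO_eq]
    exact tsum_nonneg fun k => mul_nonneg (pw_nonneg hx.1 k) (ih _ (mem_branch hx k))

lemma Fr_one {x : ℝ} (hx : x ∈ Ioc (0:ℝ) 1) : Fr 1 x = 1 / (2 + x) := by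
  have hx0 := hx.1
  rw [Fr_succ, tO_eq]
  refine HasSum.tsum_eq ?_
  rw [hasSum_iff_tendsto_nat_of_nonneg
    (fun k => mul_nonneg (pw_nonneg hx.1 k) (Fr_nonneg 0 _ (mem_branch hx k)))]
  have : ∀ N : ℕ, ∑ k ∈ Finset.range N, pw k x * Fr 0 (1 / ((k:ℝ) + 1 + x)) =
      1 / (2 + x) - (1 + x) / ((N:ℝ) + 1 + x) * (1 / ((N:ℝ) + 1 + (1 + x))) := by
    intro N
    induction N with
    | zero => simp; field_simp; ring
    | succ n ih =>
      rw [Finset.sum_range_succ, ih]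
      change _ + pw n x * h0 _ = _
      unfold pw h0; push_cast; field_simp; ring
  simp_rw [this]
  simpa using (((tendsto_aux x).const_div_atTop (1 + x)).mul
    ((tendsto_aux (1 + x)).const_div_atTop 1)).const_sub (1 / (2 + x))

lemma G_mono : MonotoneOn (fun x => Fr 1 x + 1 / 2 * Fr 0 x) (Ioc 0 1) := by
  intro x hx y hy hxy
  have hx0 := hx.1
  have hy0 := hy.1
  have hx1 := hx.2
  have hy1 := hy.2
  simp only [Fr_one hx, Fr_one hy]
  change _ + 1 / 2 * h0 x ≤ _ + 1 / 2 * h0 y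
  unfold h0
  have : (1 / (2 + y) + 1 / 2 * (2 * y / (1 + 2 * y))) - (1 / (2 + x) + 1 / 2 * (2 * x / (1 + 2 * x)))
      = (y - x) * ((2 + x) * (2 + y) - (1 + 2 * x) * (1 + 2 * y)) /
        ((2 + x) * (2 + y) * ((1 + 2 * x) * (1 + 2 * y))) := by
    field_simp; ring
  rw [← sub_nonneg, this]
  refine div_nonneg (mul_nonneg (by linarith) ?_) (by positivity)
  nlinarith

lemma G_bd : Bd 2 (fun x => Fr 1 x + 1 / 2 * Fr 0 x) := by
  intro z hz
  have h1 := abs_le.1 (Fr_bd 1 z hz)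
  have h2 := abs_le.1 (Fr_bd 0 z hz)
  rw [abs_le]; constructor <;> linarith

lemma G_iter (n : ℕ) : EqOn (transferOp^[n] (fun x => Fr 1 x + 1 / 2 * Fr 0 x))
    (fun x => Fr (n + 1) x + 1 / 2 * Fr n x) (Ioc 0 1) := by
  induction n with
  | zero => intro x hx; rfl
  | succ n ih =>
    intro x hx
    rw [Function.iterate_succ_apply', tO_congr ih hx]
    have : Bd 1 (fun x => 1 / 2 * Fr n x) := by
      intro z hz
      have h1 := abs_le.1 (Fr_bd n z hz)
      rw [abs_le]; constructor <;> linarith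
    rw [tO_add (Fr_bd (n + 1)) this hx, tO_smul, ← Fr_succ, ← Fr_succ]

lemma Gn_mono (n : ℕ) : MonotoneOn (fun x => (-1) ^ n * (Fr (n + 1) x + 1 / 2 * Fr n x)) (Ioc 0 1) := by
  refine (iter_mono G_bd G_mono n).congr ?_
  intro x hx
  simp only [G_iter n hx]

noncomputable def indA : ℝ → ENNReal := (Ico (1/2:ℝ) 1).indicator 1

lemma PE_eq (n : ℕ) : ∀ x ∈ Ioc (0:ℝ) 1, PE^[n + 1] indA x = ENNReal.ofReal (Fr (n + 1) x) := by
  induction n with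
  | zero =>
    intro x hx
    have hx0 := hx.1
    have hx1 := hx.2
    rw [Fr_one hx]
    change PE indA x = _
    unfold PE
    rw [tsum_eq_single 0]
    · have : (1 / (((0:ℕ):ℝ) + 1 + x)) ∈ Ico (1/2:ℝ) 1 := by
        constructor
        · rw [div_le_div_iff₀ (by norm_num) (by positivity)]; push_cast; linarith
        · rw [div_lt_one (by positivity)]; push_cast; linarith
      unfold indA
      rw [indicator_of_mem this]
      simp only [Pi.one_apply, mul_one]
      congr 1
      unfold pw; push_cast; field_simp; ring
    · intro k hk
      have hk1 : (1:ℝ) ≤ k := by exact_mod_cast Nat.one_le_iff_ne_zero.2 hk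
      have : (1 / ((k:ℝ) + 1 + x)) ∉ Ico (1/2:ℝ) 1 := by
        intro h
        have := h.1
        rw [div_le_div_iff₀ (by norm_num) (by positivity)] at this
        linarith
      unfold indA
      rw [indicator_of_notMem this, mul_zero]
  | succ n ih =>
    intro x hx
    rw [Function.iterate_succ_apply', Fr_succ, tO_eq, ENNReal.ofReal_tsum_of_nonneg
      (fun k => mul_nonneg (pw_nonneg hx.1 k) (Fr_nonneg _ _ (mem_branch hx k))) (summ (Fr_bd _) hx)]
    refine tsum_congr fun k => ?_
    rw [ih _ (mem_branch hx k), ENNReal.ofReal_mul (pw_nonneg hx.1 k)]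

lemma gaussMeasure_eq : gaussMeasure =
    (volume.restrict (Ico (0:ℝ) 1)).withDensity (fun x => ENNReal.ofReal (gw x)) := rfl

lemma gw_contOn : ContinuousOn gw (Icc 0 1) := by
  unfold gw
  have hl := Real.log_pos (one_lt_two)
  refine continuousOn_const.div (by fun_prop) fun x hx => ?_
  have := hx.1
  positivity

instance gauss_fin : IsFiniteMeasure gaussMeasure := by
  rw [gaussMeasure_eq]
  refine isFiniteMeasure_withDensity_ofReal ?_
  exact ((gw_contOn.integrableOn_Icc (μ := volume)).mono_set Ico_subset_Icc_self).2

lemma gauss_restrict : gaussMeasure.restrict (Ioc 0 1) = gaussMeasure := by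
  refine Measure.restrict_eq_self_of_ae_mem ?_
  have h1 : gaussMeasure ≪ volume.restrict (Ioc (0:ℝ) 1) := by
    rw [gaussMeasure_eq, ← restrict_Ico_eq_restrict_Ioc]
    exact withDensity_absolutelyContinuous _ _
  exact h1.ae_le (ae_restrict_mem measurableSet_Ioc)

lemma integrable_of_mono {C : ℝ} {h : ℝ → ℝ} (hb : Bd C h) (hm : MonotoneOn h (Ioc 0 1)) :
    Integrable h gaussMeasure := by
  have h1 : AEMeasurable h (gaussMeasure.restrict (Ioc 0 1)) :=
    aemeasurable_restrict_of_monotoneOn measurableSet_Ioc hm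
  refine Integrable.of_bound (C := C) (by rw [← gauss_restrict]; exact h1.aestronglyMeasurable) ?_
  rw [← gauss_restrict]
  filter_upwards [ae_restrict_mem measurableSet_Ioc] with x hx using hb x hx

lemma gauss_setIntegral {a b : ℝ} (ha : 0 ≤ a) (hab : a ≤ b) (hb : b ≤ 1) (h : ℝ → ℝ) :
    ∫ x in Ico a b, h x ∂gaussMeasure = ∫ x in a..b, gw x * h x := by
  rw [gaussMeasure_eq, restrict_withDensity measurableSet_Ico,
    Measure.restrict_restrict measurableSet_Ico,
    integral_withDensity_eq_integral_toReal_smul (measurable_gw.ennreal_ofReal)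
      (Eventually.of_forall fun _ => ENNReal.ofReal_lt_top),
    inter_eq_left.2 (Ico_subset_Ico ha hb), intervalIntegral.integral_of_le hab,
    ← restrict_Ico_eq_restrict_Ioc]
  refine setIntegral_congr_fun measurableSet_Ico fun x hx => ?_
  have hl := Real.log_pos (one_lt_two)
  have : 0 ≤ x := ha.trans hx.1
  simp only [smul_eq_mul]
  rw [ENNReal.toReal_ofReal]
  unfold gw; positivity

lemma gauss_int_one {a b : ℝ} (ha : 0 ≤ a) (hab : a ≤ b) (hb : b ≤ 1) :
    (gaussMeasure (Ico a b)).toReal = (Real.log (1 + b) - Real.log (1 + a)) / Real.log 2 := by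
  have h1 := gauss_setIntegral ha hab hb (fun _ => 1)
  rw [setIntegral_const, smul_eq_mul, mul_one] at h1
  change gaussMeasure.real (Ico a b) = _
  rw [h1]
  have hl := Real.log_pos (one_lt_two)
  rw [intervalIntegral.integral_eq_sub_of_hasDerivAt (f := fun x => Real.log (1 + x) / Real.log 2)]
  · ring
  · intro x hx
    rw [uIcc_of_le hab] at hx
    have : 0 ≤ x := ha.trans hx.1
    have h2 := (((hasDerivAt_id x).const_add 1).log (by simp; positivity)).div_const (Real.log 2)
    refine h2.congr_deriv ?_
    unfold gw; simp; field_simp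
  · refine ContinuousOn.intervalIntegrable ?_
    rw [uIcc_of_le hab]
    exact (gw_contOn.mono (Icc_subset_Icc ha hb)).mul continuousOn_const

lemma gauss_int_Fr {a b : ℝ} (ha : 0 ≤ a) (hab : a ≤ b) (hb : b ≤ 1) :
    ∫ x in Ico a b, Fr 1 x ∂gaussMeasure =
      ((Real.log (1 + b) - Real.log (2 + b)) - (Real.log (1 + a) - Real.log (2 + a))) / Real.log 2 := by
  rw [gauss_setIntegral ha hab hb]
  have hl := Real.log_pos (one_lt_two)
  have : ∫ x in a..b, gw x * Fr 1 x = ∫ x in a..b, gw x * (1 / (2 + x)) := by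
    rw [intervalIntegral.integral_of_le hab, intervalIntegral.integral_of_le hab]
    refine setIntegral_congr_fun measurableSet_Ioc fun x hx => ?_
    rw [Fr_one ⟨lt_of_le_of_lt ha hx.1, hx.2.trans hb⟩]
  rw [this]
  rw [intervalIntegral.integral_eq_sub_of_hasDerivAt
    (f := fun x => (Real.log (1 + x) - Real.log (2 + x)) / Real.log 2)]
  · ring
  · intro x hx
    rw [uIcc_of_le hab] at hx
    have : 0 ≤ x := ha.trans hx.1
    have h2 := ((((hasDerivAt_id x).const_add 1).log (by simp; positivity)).sub
      (((hasDerivAt_id x).const_add 2).log (by simp; positivity))).div_const (Real.log 2)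
    refine h2.congr_deriv ?_
    unfold gw; simp; field_simp; ring
  · refine ContinuousOn.intervalIntegrable ?_
    rw [uIcc_of_le hab]
    refine (gw_contOn.mono (Icc_subset_Icc ha hb)).mul (continuousOn_const.div (by fun_prop) fun x hx => ?_)
    have : 0 ≤ x := ha.trans hx.1
    positivity

lemma gauss_restrict' : gaussMeasure.restrict (Ico 0 1) = gaussMeasure := by
  rw [gaussMeasure_eq, restrict_withDensity measurableSet_Ico,
    Measure.restrict_restrict measurableSet_Ico, inter_self]

lemma gauss_univ : (gaussMeasure univ).toReal = 1 := by
  have := gauss_int_one (a := 0) (b := 1) le_rfl zero_le_one le_rfl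
  rw [← gauss_restrict', Measure.restrict_apply_univ, this]
  have hl := Real.log_pos (one_lt_two)
  norm_num

noncomputable def mA : ℝ := (gaussMeasure (Ico (1/2:ℝ) 1)).toReal

lemma mA_eq : mA = Real.log (4/3) / Real.log 2 := by
  unfold mA
  rw [gauss_int_one (by norm_num) (by norm_num) le_rfl, ← Real.log_div (by norm_num) (by norm_num)]
  norm_num

lemma mA_pos : 0 < mA := by
  rw [mA_eq]; exact div_pos (Real.log_pos (by norm_num)) (Real.log_pos (by norm_num))

lemma mA_lt : mA < 1 := by
  rw [mA_eq, div_lt_one (Real.log_pos (by norm_num))]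
  exact Real.log_lt_log (by norm_num) (by norm_num)

noncomputable def Dv (h : ℝ → ℝ) : ℝ :=
  (∫ x in Ico (1/2:ℝ) 1, h x ∂gaussMeasure) / mA - ∫ x, h x ∂gaussMeasure

lemma Dv_nonneg {C : ℝ} {h : ℝ → ℝ} (hb : Bd C h) (hm : MonotoneOn h (Ioc 0 1)) : 0 ≤ Dv h := by
  have hi := integrable_of_mono hb hm
  have hhalf : (1/2:ℝ) ∈ Ioc (0:ℝ) 1 := by norm_num
  have e1 : h (1/2) * mA ≤ ∫ x in Ico (1/2:ℝ) 1, h x ∂gaussMeasure := by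
    have : ∫ x in Ico (1/2:ℝ) 1, h (1/2) ∂gaussMeasure = h (1/2) * mA := by
      rw [setIntegral_const, smul_eq_mul, mul_comm]; rfl
    rw [← this]
    refine setIntegral_mono_on (integrable_const _) hi.integrableOn measurableSet_Ico fun x hx => ?_
    exact hm hhalf ⟨by linarith [hx.1], hx.2.le⟩ hx.1
  have e2 : ∫ x in (Ico (1/2:ℝ) 1)ᶜ, h x ∂gaussMeasure ≤ h (1/2) * (1 - mA) := by
    have h3 : ∫ x in (Ico (1/2:ℝ) 1)ᶜ, h (1/2) ∂gaussMeasure = h (1/2) * (1 - mA) := by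
      rw [setIntegral_const, smul_eq_mul, mul_comm, measureReal_compl measurableSet_Ico]
      congr 2
      exact gauss_univ
    rw [← h3]
    refine setIntegral_mono_on_ae hi.integrableOn (integrable_const _) measurableSet_Ico.compl ?_
    have h4 : ∀ᵐ x ∂gaussMeasure, x ∈ Ioo (0:ℝ) 1 := by
      have h1 : gaussMeasure ≪ volume.restrict (Ioo (0:ℝ) 1) := by
        rw [gaussMeasure_eq, restrict_Ico_eq_restrict_Ioc, restrict_Ioo_eq_restrict_Ioc]
        exact withDensity_absolutelyContinuous _ _
      exact h1.ae_le (ae_restrict_mem measurableSet_Ioo)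
    filter_upwards [h4] with x hx hxc
    refine hm ⟨hx.1, hx.2.le⟩ hhalf ?_
    by_contra hlt
    exact hxc ⟨by linarith, hx.2⟩
  have e3 := integral_add_compl (μ := gaussMeasure) (measurableSet_Ico (a := (1/2:ℝ)) (b := 1)) hi
  unfold Dv
  rw [← e3, sub_nonneg, le_div_iff₀ mA_pos]
  have := mA_pos
  have := mA_lt
  nlinarith

lemma Fr_int (n : ℕ) : Integrable (Fr n) gaussMeasure := by
  have hb : Bd 1 (fun x => (-1) ^ n * Fr n x) := by
    intro z hz
    rw [abs_mul]; simpa using Fr_bd n z hz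
  have := (integrable_of_mono hb (iter_mono h0_bd h0_mono n)).const_mul ((-1) ^ n)
  simpa [← mul_assoc, ← mul_pow] using this

lemma Dv_smul (c : ℝ) (h : ℝ → ℝ) : Dv (fun x => c * h x) = c * Dv h := by
  unfold Dv
  rw [integral_const_mul, integral_const_mul]; ring

lemma Dv_add {h g : ℝ → ℝ} (hh : Integrable h gaussMeasure) (hg : Integrable g gaussMeasure) :
    Dv (fun x => h x + g x) = Dv h + Dv g := by
  unfold Dv
  rw [integral_add hh hg, integral_add hh.integrableOn hg.integrableOn]; ring

lemma e_nonneg (n : ℕ) : 0 ≤ (-1) ^ n * Dv (Fr n) := by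
  have hb : Bd 1 (fun x => (-1) ^ n * Fr n x) := by
    intro z hz
    rw [abs_mul]; simpa using Fr_bd n z hz
  have := Dv_nonneg hb (iter_mono h0_bd h0_mono n)
  rwa [Dv_smul] at this

lemma e_step (n : ℕ) : (-1) ^ (n + 1) * Dv (Fr (n + 1)) ≤ 1 / 2 * ((-1) ^ n * Dv (Fr n)) := by
  have hb : Bd 2 (fun x => (-1) ^ n * (Fr (n + 1) x + 1 / 2 * Fr n x)) := by
    intro z hz
    rw [abs_mul]
    have h1 := abs_le.1 (Fr_bd (n + 1) z hz)
    have h2 := abs_le.1 (Fr_bd n z hz)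
    simp only [abs_pow, abs_neg, abs_one, one_pow, one_mul]
    rw [abs_le]; constructor <;> linarith
  have := Dv_nonneg hb (Gn_mono n)
  rw [Dv_smul, Dv_add (Fr_int _) ((Fr_int _).const_mul _), Dv_smul] at this
  rw [pow_succ]
  linarith

lemma e_one : (-1) ^ 1 * Dv (Fr 1) ≤ 1 / 2 ^ 3 * Real.log (3/2) := by
  unfold Dv
  have h1 : ∫ x, Fr 1 x ∂gaussMeasure = mA := by
    rw [← gauss_restrict', gauss_int_Fr le_rfl zero_le_one le_rfl, mA_eq,
      Real.log_div (by norm_num) (by norm_num)]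
    have : Real.log 4 = 2 * Real.log 2 := by
      rw [show (4:ℝ) = 2 ^ 2 by norm_num, Real.log_pow]; norm_num
    rw [this]; norm_num; ring
  have h2 : ∫ x in Ico (1/2:ℝ) 1, Fr 1 x ∂gaussMeasure = Real.log (10/9) / Real.log 2 := by
    rw [gauss_int_Fr (by norm_num) (by norm_num) le_rfl, ← Real.log_div (by norm_num) (by norm_num),
      ← Real.log_div (by norm_num) (by norm_num), ← Real.log_div (by norm_num) (by norm_num)]
    norm_num
  have hl := Real.log_pos (one_lt_two)
  have hq : 0 < Real.log (4/3) := Real.log_pos (by norm_num)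
  rw [h1, h2, mA_eq]
  have e : Real.log (10/9) / Real.log 2 / (Real.log (4/3) / Real.log 2) = Real.log (10/9) / Real.log (4/3) := by
    field_simp
  rw [e]
  have a1 := Real.sum_range_le_log_div (x := 1/19) (by norm_num) (by norm_num) 1
  have a2 := Real.log_div_le_sum_range_add (x := 1/7) (by norm_num) (by norm_num) 3
  have a3 := Real.sum_range_le_log_div (x := 1/5) (by norm_num) (by norm_num) 2
  have a4 := Real.log_two_gt_d9
  norm_num [Finset.sum_range_succ] at a1 a2 a3
  have b1 : Real.log (4/3) / Real.log 2 ≤ 0.41513 := by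
    rw [div_le_iff₀ hl]; linarith
  have b2 : 0.3658 ≤ Real.log (10/9) / Real.log (4/3) := by
    rw [le_div_iff₀ hq]; linarith
  linarith

lemma e_bound (n : ℕ) : (-1) ^ (n + 1) * Dv (Fr (n + 1)) ≤ 1 / 2 ^ (n + 3) * Real.log (3/2) := by
  induction n with
  | zero => exact e_one
  | succ n ih =>
    refine (e_step (n + 1)).trans ?_
    have : (1:ℝ) / 2 ^ (n + 1 + 3) * Real.log (3/2) = 1 / 2 * (1 / 2 ^ (n + 3) * Real.log (3/2)) := by
      rw [show n + 1 + 3 = (n + 3) + 1 by ring, pow_succ]; field_simp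
    rw [this]
    linarith

lemma measurable_indA : Measurable indA := measurable_one.indicator measurableSet_Ico

lemma meas_iter (n : ℕ) : Measurable (PE^[n] indA) := by
  induction n with
  | zero => exact measurable_indA
  | succ n ih => rw [Function.iterate_succ']; exact measurable_PE ih

lemma corr_eq (n : ℕ) {B : Set ℝ} (hB : MeasurableSet B) :
    (gaussMeasure (Ico (1/2 : ℝ) 1 ∩ gaussMap^[n + 1] ⁻¹' B)).toReal =
      ∫ x in B, Fr (n + 1) x ∂gaussMeasure := by
  have h := duality_iter (g := B.indicator 1) (measurable_one.indicator hB) (n + 1) measurable_indA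
  have hm : MeasurableSet (Ico (1/2 : ℝ) 1 ∩ gaussMap^[n + 1] ⁻¹' B) :=
    measurableSet_Ico.inter ((measurable_gaussMap.iterate (n + 1)) hB)
  have l : ∫⁻ x, indA x * (B.indicator 1 : ℝ → ENNReal) (gaussMap^[n + 1] x) ∂gaussMeasure =
      gaussMeasure (Ico (1/2 : ℝ) 1 ∩ gaussMap^[n + 1] ⁻¹' B) := by
    rw [← lintegral_indicator_one hm]
    refine lintegral_congr fun x => ?_
    rw [inter_indicator_one]
    rfl
  rw [← l, h]
  have r : ∫⁻ x, PE^[n + 1] indA x * (B.indicator 1 : ℝ → ENNReal) x ∂gaussMeasure =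
      ∫⁻ x in B, ENNReal.ofReal (Fr (n + 1) x) ∂gaussMeasure := by
    rw [← lintegral_indicator hB]
    have : ∀ᵐ x ∂gaussMeasure, x ∈ Ioc (0:ℝ) 1 := by
      rw [← gauss_restrict]; exact ae_restrict_mem measurableSet_Ioc
    refine lintegral_congr_ae ?_
    filter_upwards [this] with x hx
    rw [PE_eq n x hx]
    by_cases hxB : x ∈ B <;> simp [hxB]
  rw [r, integral_eq_lintegral_of_nonneg_ae]
  · have : ∀ᵐ x ∂gaussMeasure, x ∈ Ioc (0:ℝ) 1 := by
      rw [← gauss_restrict]; exact ae_restrict_mem measurableSet_Ioc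
    filter_upwards [ae_restrict_of_ae this] with x hx using Fr_nonneg _ x hx
  · exact (Fr_int _).integrableOn.aestronglyMeasurable

theorem gauss_correlation_bound (n : ℕ) (hn : 2 ≤ n) :
    |(gaussMeasure (Set.Ico (1/2 : ℝ) 1 ∩ gaussMap^[n] ⁻¹' Set.Ico (1/2 : ℝ) 1)).toReal /
        (gaussMeasure (Set.Ico (1/2 : ℝ) 1)).toReal -
      (gaussMeasure (Set.Ico (1/2 : ℝ) 1)).toReal| ≤
      (1 / 2^(n+2)) * Real.log (3/2) := by
  obtain ⟨n, rfl⟩ : ∃ m, n = m + 1 := ⟨n - 1, by omega⟩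
  have h1 := corr_eq n (measurableSet_Ico (a := (1/2:ℝ)) (b := 1))
  have h2 := corr_eq n MeasurableSet.univ
  rw [preimage_univ, inter_univ, setIntegral_univ] at h2
  have h3 : (∫ x in Ico (1/2:ℝ) 1, Fr (n + 1) x ∂gaussMeasure) /
      (gaussMeasure (Ico (1/2:ℝ) 1)).toReal - (gaussMeasure (Ico (1/2:ℝ) 1)).toReal =
      Dv (Fr (n + 1)) := by
    unfold Dv
    rw [← h2]
    rfl
  rw [h1, h3]
  have h4 : |Dv (Fr (n + 1))| = (-1) ^ (n + 1) * Dv (Fr (n + 1)) := by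
    rw [← abs_of_nonneg (e_nonneg (n + 1)), abs_mul]
    simp
  rw [h4]
  exact e_bound n
end

section
/- Suppose x ∈ [0,1) is irrational and CF-normal, and let m ≥ 1, 1 ≤ k ≤ m. Then the limit as n → ∞ of (1/n)·#{0 ≤ i ≤ n : T^{mi+k−1} x ∈ A ∩ T^{-m}A} exists and equals μ(A ∩ T^{-m}A), where A = [1/2,1), T is the Gauss map, and μ the Gauss measure. -/
open MeasureTheory Filter Set

lemma avg_shift (w : ℕ → ℝ) (C : ℝ) (hw : ∀ i, |w i| ≤ C) (a : ℕ) (l : ℝ)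
    (h : Tendsto (fun N : ℕ => (∑ i ∈ Finset.range N, w i) / N) atTop (nhds l)) :
    Tendsto (fun N : ℕ => (∑ i ∈ Finset.range N, w (i + a)) / N) atTop (nhds l) := by
  have key : ∀ N, |∑ i ∈ Finset.range N, w (i + a) - ∑ i ∈ Finset.range N, w i| ≤ 2 * a * C := by
    intro N
    have e1 := Finset.sum_range_add w N a
    have e2 := Finset.sum_range_add w a N
    rw [add_comm a N] at e2
    have b1 : |∑ i ∈ Finset.range a, w i| ≤ a * C := by
      refine (Finset.abs_sum_le_sum_abs _ _).trans ?_
      refine (Finset.sum_le_sum fun i _ => hw i).trans ?_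
      simp
    have b2 : |∑ i ∈ Finset.range a, w (N + i)| ≤ a * C := by
      refine (Finset.abs_sum_le_sum_abs _ _).trans ?_
      refine (Finset.sum_le_sum fun i _ => hw _).trans ?_
      simp
    have e3 : ∑ i ∈ Finset.range N, w (i + a) = ∑ i ∈ Finset.range N, w (a + i) :=
      Finset.sum_congr rfl fun i _ => by rw [add_comm]
    rw [e3]
    rw [abs_le] at *
    constructor <;> linarith [b1.1, b1.2, b2.1, b2.2]
  have h2 : Tendsto (fun N : ℕ => (∑ i ∈ Finset.range N, w (i + a)) / N -
      (∑ i ∈ Finset.range N, w i) / N) atTop (nhds 0) := by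
    refine squeeze_zero_norm (a := fun N : ℕ => (2 * a * C) / N) ?_
      (tendsto_const_div_atTop_nhds_zero_nat _)
    intro N
    rw [← sub_div, norm_div, Real.norm_eq_abs, Real.norm_natCast]
    gcongr
    exact key N
  simpa using h2.add h

lemma avg_succ (w : ℕ → ℝ) (C : ℝ) (hw : ∀ i, |w i| ≤ C) (l : ℝ) :
    Tendsto (fun N : ℕ => (∑ i ∈ Finset.range (N + 1), w i) / N) atTop (nhds l) ↔
    Tendsto (fun N : ℕ => (∑ i ∈ Finset.range N, w i) / N) atTop (nhds l) := by
  have h2 : Tendsto (fun N : ℕ => w N / N) atTop (nhds 0) := by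
    refine squeeze_zero_norm (a := fun N : ℕ => C / N) ?_
      (tendsto_const_div_atTop_nhds_zero_nat _)
    intro N
    rw [norm_div, Real.norm_eq_abs, Real.norm_natCast]
    gcongr
    exact hw N
  constructor
  · intro h
    have := h.sub h2
    simpa [Finset.sum_range_succ, add_div] using this
  · intro h
    have := h.add h2
    simpa [Finset.sum_range_succ, add_div] using this

lemma seq_key (v : ℕ → ℝ) (hv : ∀ i, |v i| ≤ 1) (γ : ℕ → ℝ)
    (hγ : ∀ d, Tendsto (fun N : ℕ => (∑ i ∈ Finset.range N, v i * v (i + d)) / N) atTop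
      (nhds (γ d)))
    (hγ0 : Tendsto γ atTop (nhds 0)) (m j : ℕ) (hm : 1 ≤ m) :
    Tendsto (fun N : ℕ => (∑ i ∈ Finset.range N, v (m * i + j)) / N) atTop (nhds 0) := by
  have hvv : ∀ d i, |v i * v (i + d)| ≤ 1 := fun d i => by
    rw [abs_mul]; exact mul_le_one₀ (hv _) (abs_nonneg _) (hv _)
  have hγ1 : ∀ d, γ d ≤ 1 := by
    intro d
    refine le_of_tendsto (hγ d) (Eventually.of_forall fun N => ?_)
    refine div_le_one_of_le₀ ?_ (Nat.cast_nonneg _)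
    refine (Finset.sum_le_sum fun i _ => (le_abs_self _).trans (hvv d i)).trans ?_
    simp
  -- main estimate
  have main : ∀ L : ℕ, 1 ≤ L → ∀ ε : ℝ, 0 < ε →
      ∀ᶠ N : ℕ in atTop, ((∑ i ∈ Finset.range N, v (m * i + j)) / N) ^ 2 ≤
        2 * ε + 4 * (m + 1) * (1 / L + 2 * ε) := by
    intro L hL ε hε
    obtain ⟨D, hD⟩ := (eventually_atTop.1 (hγ0.eventually (gt_mem_nhds hε)))
    have hDp : 0 < D + 1 := Nat.succ_pos _
    set q := D + 1 with hq
    set H : ℕ → ℝ := fun i => ∑ l ∈ Finset.range L, v (i + m * (q * l)) with hH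
    -- average of H^2
    have hH2 : ∀ᶠ M : ℕ in atTop, (∑ i ∈ Finset.range M, H i ^ 2) / M ≤ L + L ^ 2 * (2 * ε) := by
      have hlim : Tendsto (fun M : ℕ => (∑ i ∈ Finset.range M, H i ^ 2) / M) atTop
          (nhds (∑ l ∈ Finset.range L, ∑ l' ∈ Finset.range L,
            γ (m * (q * ((l - l') + (l' - l)))))) := by
        have : (fun M : ℕ => (∑ i ∈ Finset.range M, H i ^ 2) / M) = fun M : ℕ =>
          ∑ l ∈ Finset.range L, ∑ l' ∈ Finset.range L,
            (∑ i ∈ Finset.range M, v (i + m * (q * l)) * v (i + m * (q * l'))) / M := by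
          funext M
          simp only [hH, sq, Finset.sum_mul_sum]
          rw [Finset.sum_comm, Finset.sum_div]
          refine Finset.sum_congr rfl fun l _ => ?_
          rw [Finset.sum_comm, Finset.sum_div]
        rw [this]
        refine tendsto_finsetSum _ fun l _ => tendsto_finsetSum _ fun l' _ => ?_
        rcases le_total l l' with h | h
        · obtain ⟨d, rfl⟩ := Nat.exists_eq_add_of_le h
          have := avg_shift _ 1 (hvv (m * (q * d))) (m * (q * l)) _ (hγ (m * (q * d)))
          convert this using 6 <;> first | omega | ring_nf
        · obtain ⟨d, rfl⟩ := Nat.exists_eq_add_of_le h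
          have := avg_shift _ 1 (hvv (m * (q * d))) (m * (q * l')) _ (hγ (m * (q * d)))
          convert this using 4
          · rw [mul_comm]; ring_nf
          · simp
      have hlt : (∑ l ∈ Finset.range L, ∑ l' ∈ Finset.range L,
            γ (m * (q * ((l - l') + (l' - l))))) < L + L ^ 2 * (2 * ε) := by
        have : ∀ l ∈ Finset.range L, ∀ l' ∈ Finset.range L, 
            γ (m * (q * ((l - l') + (l' - l)))) ≤ (if l = l' then 1 else 0) + ε := by
          intro l _ l' _
          split_ifs with h
          · linarith [hγ1 (m * (q * ((l - l') + (l' - l))))]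
          · rw [zero_add]
            refine (hD _ ?_).le
            have h1 : 1 ≤ (l - l') + (l' - l) := by omega
            calc D ≤ 1 * (q * 1) := by omega
              _ ≤ _ := by gcongr
        have h3 := Finset.sum_le_sum fun l hl => Finset.sum_le_sum (this l hl)
        refine h3.trans_lt ?_
        simp only [Finset.sum_add_distrib, Finset.sum_ite_eq, Finset.sum_const, Finset.card_range]
        have h4 : ∑ x ∈ Finset.range L, (if x ∈ Finset.range L then (1:ℝ) else 0) = L := by
          rw [Finset.sum_congr rfl fun x hx => if_pos hx]; simp
        rw [h4]
        have : (0:ℝ) < L := by exact_mod_cast hL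
        simp only [nsmul_eq_mul]
        have : 0 < (L:ℝ)^2 * ε := by positivity
        nlinarith
      exact (hlim.eventually (gt_mem_nhds hlt)).mono fun _ h => h.le
    have htend : Tendsto (fun N : ℕ => m * N + j) atTop atTop := by
      refine tendsto_atTop_mono (fun N => ?_) tendsto_id
      simp only [id]; nlinarith
    -- comparision
    have hcomp : ∀ N : ℕ, |L * ∑ i ∈ Finset.range N, v (m * i + j)| ≤
        2 * L * (q * L) + |∑ i ∈ Finset.range N, H (m * i + j)| := by
      intro N
      have e : ∑ i ∈ Finset.range N, H (m * i + j) = ∑ l ∈ Finset.range L,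
          ∑ i ∈ Finset.range N, v (m * (i + q * l) + j) := by
        rw [Finset.sum_comm]
        refine Finset.sum_congr rfl fun i _ => Finset.sum_congr rfl fun l _ => ?_
        congr 1; ring
      have b : ∀ l ∈ Finset.range L, |∑ i ∈ Finset.range N, v (m * i + j) - 
          ∑ i ∈ Finset.range N, v (m * (i + q * l) + j)| ≤ 2 * (q * L) := by
        intro l hl
        have hlL : (l:ℝ) ≤ L := by exact_mod_cast (Finset.mem_range.1 hl).le
        set w : ℕ → ℝ := fun i => v (m * i + j)
        have e1 := Finset.sum_range_add w N (q * l)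
        have e2 := Finset.sum_range_add w (q * l) N
        rw [add_comm (q * l) N] at e2
        have b1 : |∑ i ∈ Finset.range (q * l), w i| ≤ q * l := by
          refine (Finset.abs_sum_le_sum_abs _ _).trans ?_
          refine (Finset.sum_le_sum fun i _ => hv _).trans ?_
          simp
        have b2 : |∑ i ∈ Finset.range (q * l), w (N + i)| ≤ q * l := by
          refine (Finset.abs_sum_le_sum_abs _ _).trans ?_
          refine (Finset.sum_le_sum fun i _ => hv _).trans ?_
          simp
        have e3 : ∑ i ∈ Finset.range N, v (m * (i + q * l) + j) =
            ∑ i ∈ Finset.range N, w (q * l + i) :=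
          Finset.sum_congr rfl fun i _ => by simp only [w]; rw [add_comm i]
        rw [e3]
        have : (q:ℝ) * l ≤ q * L := by gcongr
        rw [abs_le] at *
        constructor <;> linarith [b1.1, b1.2, b2.1, b2.2]
      have : |L * ∑ i ∈ Finset.range N, v (m * i + j) - ∑ i ∈ Finset.range N, H (m * i + j)|
          ≤ 2 * L * (q * L) := by
        have e4 : L * ∑ i ∈ Finset.range N, v (m * i + j) - ∑ i ∈ Finset.range N, H (m * i + j)
          = ∑ l ∈ Finset.range L, (∑ i ∈ Finset.range N, v (m * i + j) - 
          ∑ i ∈ Finset.range N, v (m * (i + q * l) + j)) := by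
          rw [e, Finset.sum_sub_distrib]; simp
        rw [e4]
        refine (Finset.abs_sum_le_sum_abs _ _).trans ((Finset.sum_le_sum b).trans ?_)
        simp; linarith
      have t := abs_sub_abs_le_abs_sub (L * ∑ i ∈ Finset.range N, v (m * i + j))
        (∑ i ∈ Finset.range N, H (m * i + j))
      linarith
    have hCS : ∀ N : ℕ, (∑ i ∈ Finset.range N, H (m * i + j)) ^ 2 ≤
        N * ∑ i ∈ Finset.range (m * N + j), H i ^ 2 := by
      intro N
      have := sq_sum_le_card_mul_sum_sq (s := Finset.range N) (f := fun i => H (m * i + j))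
      rw [Finset.card_range] at this
      refine this.trans ?_
      gcongr
      have hinj : Function.Injective (fun i : ℕ => m * i + j) := by
        intro a b hab
        simp only at hab
        exact Nat.eq_of_mul_eq_mul_left hm (by omega)
      rw [← Finset.sum_image (s := Finset.range N) (g := fun i => m * i + j)
        (f := fun i => H i ^ 2) (fun a _ b _ h => hinj h)]
      refine Finset.sum_le_sum_of_subset_of_nonneg ?_ (fun _ _ _ => sq_nonneg _)
      intro i hi
      obtain ⟨a, ha, rfl⟩ := Finset.mem_image.1 hi
      rw [Finset.mem_range] at *
      have : m * a < m * N := Nat.mul_lt_mul_of_pos_left ha hm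
      omega
    have hsmall : ∀ᶠ N : ℕ in atTop, 2 * (2 * (q * L) / (N:ℝ)) ^ 2 ≤ 2 * ε := by
      have h1 := tendsto_const_div_atTop_nhds_zero_nat (2 * ((q:ℝ) * L))
      have h2 := (h1.pow 2).const_mul 2
      simp only [ne_eq, OfNat.ofNat_ne_zero, not_false_eq_true, zero_pow, mul_zero] at h2
      exact (h2.eventually (gt_mem_nhds (show 0 < 2 * ε by positivity))).mono fun _ h => h.le
    filter_upwards [htend.eventually hH2, hsmall, eventually_ge_atTop (j + 1)] with N h1 h2 h3
    have hNpos : (0:ℝ) < N := by exact_mod_cast (by omega : 0 < N)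
    have hjN : (j:ℝ) ≤ N := by exact_mod_cast (by omega : j ≤ N)
    have hLpos : (0:ℝ) < L := by exact_mod_cast hL
    have hm1 : (1:ℝ) ≤ m := by exact_mod_cast hm
    have hMpos : (0:ℝ) < ((m * N + j : ℕ) : ℝ) := by
      push_cast; positivity
    rw [div_le_iff₀ hMpos] at h1
    set S := ∑ i ∈ Finset.range N, v (m * i + j)
    set K := ∑ i ∈ Finset.range N, H (m * i + j)
    have hK : K ^ 2 ≤ N * ((L + L ^ 2 * (2 * ε)) * ((m + 1) * N)) := by
      refine (hCS N).trans ?_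
      gcongr
      refine h1.trans ?_
      gcongr
      push_cast; linarith
    have hS : (L * S) ^ 2 ≤ 2 * (2 * L * (q * L)) ^ 2 + 2 * K ^ 2 := by
      have a1 := hcomp N
      have a2 : (L * S) ^ 2 ≤ (2 * L * (q * L) + |K|) ^ 2 := by
        rw [← sq_abs (L * S)]
        exact pow_le_pow_left₀ (abs_nonneg _) a1 2
      have := sq_nonneg (2 * L * (q * L) - |K|)
      nlinarith [sq_abs K]
    have e : (S / N) ^ 2 = (L * S) ^ 2 / (L ^ 2 * N ^ 2) := by field_simp
    rw [e, div_le_iff₀ (by positivity)]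
    have e2 : 2 * (2 * (q * L) / (N:ℝ)) ^ 2 * (L ^ 2 * N ^ 2) = 2 * (2 * L * (q * L)) ^ 2 := by
      field_simp
    have h2' := mul_le_mul_of_nonneg_right h2 (by positivity : 0 ≤ (L:ℝ) ^ 2 * N ^ 2)
    rw [e2] at h2'
    have e3 : (4 * (m + 1) * (1 / L + 2 * ε)) * ((L:ℝ) ^ 2 * N ^ 2) =
      4 * (N * ((L + L ^ 2 * (2 * ε)) * ((m + 1) * N))) := by field_simp
    have : 0 ≤ N * ((L + L ^ 2 * (2 * ε)) * ((m + 1) * (N:ℝ))) := by positivity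
    rw [add_mul, e3]
    linarith
  rw [Metric.tendsto_atTop']
  intro δ hδ
  have hmp : (0:ℝ) < m + 1 := by positivity
  set ε := δ ^ 2 / (100 * (m + 1)) with hε
  have hεp : 0 < ε := by positivity
  obtain ⟨L, hL⟩ := exists_nat_one_div_lt hεp
  obtain ⟨N0, hN0⟩ := eventually_atTop.1 (main (L + 1) (by omega) ε hεp)
  refine ⟨N0, fun N hN => ?_⟩
  rw [dist_zero_right, Real.norm_eq_abs]
  refine abs_lt_of_sq_lt_sq ((hN0 N hN.le).trans_lt ?_) hδ.le
  push_cast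
  have h1 : ε * (m + 1) = δ ^ 2 / 100 := by rw [hε]; field_simp
  have h2 : ε ≤ δ ^ 2 / 100 := by
    rw [← h1]; nlinarith [(Nat.cast_nonneg m : (0:ℝ) ≤ m)]
  have h3 : 4 * ((m:ℝ) + 1) * (1 / (L + 1) + 2 * ε) ≤ 4 * (m + 1) * (ε + 2 * ε) := by
    gcongr
  have : 0 < δ ^ 2 := by positivity
  nlinarith

noncomputable def pkk (k : ℕ) (x : ℝ) : ℝ := (1 + x) / (((k:ℝ) + 1 + x) * ((k:ℝ) + 2 + x))

lemma pkk_nonneg (k : ℕ) {x : ℝ} (hx : 0 ≤ x) : 0 ≤ pkk k x := by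
  unfold pkk; positivity

lemma pkk_hasSum {x : ℝ} (hx : 0 ≤ x) : HasSum (fun k => pkk k x) 1 := by
  rw [hasSum_iff_tendsto_nat_of_nonneg (fun k => pkk_nonneg k hx)]
  have h : ∀ n : ℕ, ∑ k ∈ Finset.range n, pkk k x = 1 - (1 + x) / (n + (1 + x)) := by
    intro n
    induction n with
    | zero => simp; field_simp; simp
    | succ n ih =>
      rw [Finset.sum_range_succ, ih]
      unfold pkk
      have h1 : (n:ℝ) + 1 + x ≠ 0 := by positivity
      have h2 : (n:ℝ) + 2 + x ≠ 0 := by positivity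
      have h3 : (n:ℝ) + (1 + x) ≠ 0 := by positivity
      have h4 : (n:ℝ) + 1 + (1 + x) ≠ 0 := by positivity
      push_cast
      field_simp
      ring
  simp_rw [h]
  have : Tendsto (fun n : ℕ => (1 + x) / ((n:ℝ) + (1 + x))) atTop (nhds 0) := by
    refine Tendsto.div_atTop tendsto_const_nhds ?_
    exact tendsto_atTop_add_const_right _ _ tendsto_natCast_atTop_atTop
  simpa using this.const_sub 1

lemma pkk_summable_mul {x : ℝ} (hx : 0 ≤ x) (g : ℕ → ℝ) (C : ℝ) (hg : ∀ k, |g k| ≤ C) :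
    Summable (fun k => pkk k x * g k) := by
  refine Summable.of_norm_bounded ((pkk_hasSum hx).summable.mul_right C) fun k => ?_
  rw [norm_mul, Real.norm_of_nonneg (pkk_nonneg k hx)]
  exact mul_le_mul_of_nonneg_left (hg k) (pkk_nonneg k hx)

lemma branch_mem (k : ℕ) {x : ℝ} (hx : x ∈ Icc (0:ℝ) 1) :
    1 / ((k:ℝ) + 1 + x) ∈ Icc (0:ℝ) 1 := by
  have := hx.1
  have hk : (0:ℝ) ≤ k := Nat.cast_nonneg k
  refine ⟨by positivity, ?_⟩
  rw [div_le_one (by positivity)]; linarith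

lemma branch_anti (k : ℕ) {x y : ℝ} (hx : 0 ≤ x) (hxy : x ≤ y) :
    1 / ((k:ℝ) + 1 + y) ≤ 1 / ((k:ℝ) + 1 + x) := by
  gcongr

lemma mono_bdd {f : ℝ → ℝ} (hf : MonotoneOn f (Icc 0 1)) {x : ℝ} (hx : x ∈ Icc (0:ℝ) 1) :
    |f x| ≤ |f 0| + |f 1| := by
  have h0 := hf (left_mem_Icc.2 zero_le_one) hx hx.1
  have h1 := hf hx (right_mem_Icc.2 zero_le_one) hx.2
  rw [abs_le]
  constructor
  · linarith [neg_abs_le (f 0), abs_nonneg (f 1)]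
  · linarith [le_abs_self (f 1), abs_nonneg (f 0)]

lemma transferOp_eq (f : ℝ → ℝ) (x : ℝ) :
    transferOp f x = ∑' k : ℕ, pkk k x * f (1 / ((k:ℝ) + 1 + x)) := rfl

lemma pkk_cross {x y : ℝ} (hx : 0 ≤ x) (hxy : x ≤ y) (hy : y ≤ 1) (g : ℕ → ℝ) (hg : Antitone g)
    (k : ℕ) : 0 ≤ (pkk k x - pkk k y) * (g k - g 1) := by
  have hk : (0:ℝ) ≤ k := Nat.cast_nonneg k
  have hy0 : 0 ≤ y := hx.trans hxy
  have e : pkk k x - pkk k y = (y - x) * (-((k:ℝ) + 1) ^ 2 + (k + 1) + (1 + x) * (1 + y)) /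
      (((k:ℝ) + 1 + x) * ((k:ℝ) + 2 + x) * (((k:ℝ) + 1 + y) * ((k:ℝ) + 2 + y))) := by
    unfold pkk
    rw [div_sub_div _ _ (by positivity) (by positivity)]
    congr 1
    ring
  rcases k with _ | _ | k
  · refine mul_nonneg ?_ (sub_nonneg.2 (hg (by norm_num)))
    rw [e]
    refine div_nonneg (mul_nonneg (by linarith) ?_) (by positivity)
    push_cast
    nlinarith [mul_nonneg hx hy0]
  · simp
  · refine mul_nonneg_of_nonpos_of_nonpos ?_ (sub_nonpos.2 (hg (by omega)))
    rw [e]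
    refine div_nonpos_of_nonpos_of_nonneg ?_ (by positivity)
    refine mul_nonpos_of_nonneg_of_nonpos (by linarith) ?_
    push_cast
    have : (0:ℝ) ≤ k := Nat.cast_nonneg k
    nlinarith [mul_nonneg hx hy0, mul_le_mul hxy hy hy0 hy0]

lemma transfer_anti {f : ℝ → ℝ} (hf : MonotoneOn f (Icc 0 1)) :
    AntitoneOn (transferOp f) (Icc 0 1) := by
  intro x hx y hy hxy
  rw [transferOp_eq, transferOp_eq]
  set g : ℕ → ℝ := fun k => f (1 / ((k:ℝ) + 1 + y)) with hg
  have hgb : ∀ k, |g k| ≤ |f 0| + |f 1| := fun k => mono_bdd hf (branch_mem k hy)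
  have hga : Antitone g := by
    intro a b hab
    refine hf (branch_mem b hy) (branch_mem a hy) ?_
    have : (a:ℝ) ≤ b := by exact_mod_cast hab
    have := hy.1
    gcongr
  have s1 := pkk_summable_mul hx.1 g _ hgb
  have s2 := pkk_summable_mul hy.1 g _ hgb
  have hx0 := pkk_hasSum hx.1
  have hy0 := pkk_hasSum hy.1
  have h1 : ∑' k, pkk k x * g k ≤ ∑' k : ℕ, pkk k x * f (1 / ((k:ℝ) + 1 + x)) := by
    refine s1.tsum_le_tsum (fun k => ?_)
      (pkk_summable_mul hx.1 _ _ fun k => mono_bdd hf (branch_mem k hx))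
    exact mul_le_mul_of_nonneg_left (hf (branch_mem k hy) (branch_mem k hx)
      (branch_anti k hx.1 hxy)) (pkk_nonneg k hx.1)
  refine le_trans ?_ h1
  have h2 : HasSum (fun k => (pkk k x - pkk k y) * (g k - g 1))
      (∑' k, pkk k x * g k - ∑' k, pkk k y * g k - (1 * g 1 - 1 * g 1)) := by
    have := (s1.hasSum.sub s2.hasSum).sub ((hx0.mul_right (g 1)).sub (hy0.mul_right (g 1)))
    refine this.congr_fun ?_ |> fun h => h
    intro k; ring
  have h3 := h2.nonneg (pkk_cross hx.1 hxy hy.2 g hga)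
  change ∑' k, pkk k y * g k ≤ _
  linarith

lemma transfer_osc {f : ℝ → ℝ} (hf : MonotoneOn f (Icc 0 1)) :
    transferOp f 0 - transferOp f 1 ≤ (f 1 - f 0) / 2 := by
  rw [transferOp_eq, transferOp_eq]
  have m0 : (0:ℝ) ∈ Icc (0:ℝ) 1 := by simp
  have m1 : (1:ℝ) ∈ Icc (0:ℝ) 1 := by simp
  have s0 := pkk_summable_mul m0.1 (fun k : ℕ => f (1 / ((k:ℝ) + 1 + 0))) _
    fun k => mono_bdd hf (branch_mem k m0)
  have s1 := pkk_summable_mul m1.1 (fun k : ℕ => f (1 / ((k:ℝ) + 1 + 1))) _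
    fun k => mono_bdd hf (branch_mem k m1)
  rw [s0.tsum_eq_zero_add]
  have e : ∀ k : ℕ, pkk (k + 1) 0 * f (1 / (((k + 1 : ℕ):ℝ) + 1 + 0)) =
      (1 / 2) * (pkk k 1 * f (1 / ((k:ℝ) + 1 + 1))) := by
    intro k
    have : pkk (k + 1) 0 = 1 / 2 * pkk k 1 := by
      unfold pkk
      push_cast
      field_simp
      ring
    rw [this]; push_cast; rw [add_zero, mul_assoc]
  simp_rw [e]
  rw [tsum_mul_left]
  have h2 : f 0 ≤ ∑' k : ℕ, pkk k 1 * f (1 / ((k:ℝ) + 1 + 1)) := by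
    have := (pkk_hasSum m1.1).mul_right (f 0)
    rw [one_mul] at this
    refine hasSum_le (fun k => ?_) this s1.hasSum
    exact mul_le_mul_of_nonneg_left (hf m0 (branch_mem k m1) (branch_mem k m1).1)
      (pkk_nonneg k m1.1)
  have h0 : pkk 0 0 * f (1 / (((0:ℕ):ℝ) + 1 + 0)) = f 1 / 2 := by
    unfold pkk; norm_num; ring
  rw [h0]
  linarith

lemma transfer_neg (f : ℝ → ℝ) : transferOp (fun x => - f x) = fun x => - transferOp f x := by
  funext x
  rw [transferOp_eq, transferOp_eq, ← tsum_neg]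
  simp

/-- Monotone in some direction on the unit interval, with oscillation at most `δ`. -/
def MonOsc (f : ℝ → ℝ) (δ : ℝ) : Prop :=
  (MonotoneOn f (Icc 0 1) ∧ f 1 - f 0 ≤ δ) ∨ (AntitoneOn f (Icc 0 1) ∧ f 0 - f 1 ≤ δ)

lemma MonOsc.transfer {f : ℝ → ℝ} {δ : ℝ} (h : MonOsc f δ) : MonOsc (transferOp f) (δ / 2) := by
  rcases h with ⟨h1, h2⟩ | ⟨h1, h2⟩
  · exact Or.inr ⟨transfer_anti h1, by linarith [transfer_osc h1]⟩
  · have h1' : MonotoneOn (fun x => - f x) (Icc 0 1) := h1.neg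
    have a := transfer_anti h1'
    have b := transfer_osc h1'
    rw [transfer_neg] at a b
    refine Or.inl ⟨fun x hx y hy hxy => ?_, by linarith⟩
    have := a hx hy hxy
    simpa using this

lemma MonOsc.bdd {f : ℝ → ℝ} {δ : ℝ} (h : MonOsc f δ) {x : ℝ} (hx : x ∈ Icc (0:ℝ) 1) :
    |f x| ≤ |f 0| + |f 1| := by
  rcases h with ⟨h1, h2⟩ | ⟨h1, h2⟩
  · exact mono_bdd h1 hx
  · have h1' : MonotoneOn (fun x => - f x) (Icc 0 1) := h1.neg
    simpa using mono_bdd h1' hx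

lemma MonOsc.lohi {f : ℝ → ℝ} {δ : ℝ} (h : MonOsc f δ) {x : ℝ} (hx : x ∈ Icc (0:ℝ) 1) :
    min (f 0) (f 1) ≤ f x ∧ f x ≤ min (f 0) (f 1) + δ := by
  have m0 : (0:ℝ) ∈ Icc (0:ℝ) 1 := by simp
  have m1 : (1:ℝ) ∈ Icc (0:ℝ) 1 := by simp
  rcases h with ⟨h1, h2⟩ | ⟨h1, h2⟩
  · have a := h1 m0 hx hx.1
    have b := h1 hx m1 hx.2
    rw [min_eq_left (a.trans b)]
    constructor <;> linarith
  · have a := h1 m0 hx hx.1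
    have b := h1 hx m1 hx.2
    rw [min_eq_right (b.trans a)]
    constructor <;> linarith

lemma transfer_nonneg {f : ℝ → ℝ} (hf : ∀ x ∈ Icc (0:ℝ) 1, 0 ≤ f x) :
    ∀ x ∈ Icc (0:ℝ) 1, 0 ≤ transferOp f x := by
  intro x hx
  rw [transferOp_eq]
  exact tsum_nonneg fun k => mul_nonneg (pkk_nonneg k hx.1) (hf _ (branch_mem k hx))

lemma MonOsc.branch_aemeas {f : ℝ → ℝ} {δ : ℝ} (h : MonOsc f δ) (k : ℕ) :
    AEMeasurable (fun y => f (1 / ((k:ℝ) + 1 + y))) (volume.restrict (Ico (0:ℝ) 1)) := by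
  have hsub : ∀ x ∈ Ico (0:ℝ) 1, x ∈ Icc (0:ℝ) 1 := fun x hx => ⟨hx.1, hx.2.le⟩
  rcases h with ⟨h1, h2⟩ | ⟨h1, h2⟩
  · refine aemeasurable_restrict_of_antitoneOn measurableSet_Ico ?_
    intro x hx y hy hxy
    exact h1 (branch_mem k (hsub _ hy)) (branch_mem k (hsub _ hx)) (branch_anti k hx.1 hxy)
  · refine aemeasurable_restrict_of_monotoneOn measurableSet_Ico ?_
    intro x hx y hy hxy
    exact h1 (branch_mem k (hsub _ hy)) (branch_mem k (hsub _ hx)) (branch_anti k hx.1 hxy)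

lemma gaussMap_branch (k : ℕ) {y : ℝ} (hy : y ∈ Ico (0:ℝ) 1) :
    gaussMap (1 / ((k:ℝ) + 1 + y)) = y := by
  unfold gaussMap
  rw [one_div, inv_inv]
  have : (k:ℝ) + 1 + y = ((k + 1 : ℕ) : ℝ) + y := by push_cast; ring
  rw [this, Int.fract_natCast_add]
  exact Int.fract_eq_self.2 hy

lemma branch_union : (⋃ k : ℕ, (fun y : ℝ => 1 / ((k:ℝ) + 1 + y)) '' Ico (0:ℝ) 1) = Ioc 0 1 := by
  ext x
  simp only [mem_iUnion, mem_image]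
  constructor
  · rintro ⟨k, y, hy, rfl⟩
    have := hy.1
    have hk : (0:ℝ) ≤ k := Nat.cast_nonneg k
    refine ⟨by positivity, ?_⟩
    rw [div_le_one (by positivity)]; linarith
  · intro hx
    have h1 : 1 ≤ x⁻¹ := (one_le_inv₀ hx.1).2 hx.2
    have h2 : 1 ≤ ⌊x⁻¹⌋₊ := Nat.le_floor (by simpa using h1)
    refine ⟨⌊x⁻¹⌋₊ - 1, x⁻¹ - ⌊x⁻¹⌋₊, ⟨?_, ?_⟩, ?_⟩
    · linarith [Nat.floor_le (zero_le_one.trans h1)]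
    · linarith [Nat.lt_floor_add_one x⁻¹]
    · push_cast [h2]
      simp

lemma branch_disj : Pairwise (Function.onFun Disjoint
    fun k : ℕ => (fun y : ℝ => 1 / ((k:ℝ) + 1 + y)) '' Ico (0:ℝ) 1) := by
  intro a b hab
  rw [Function.onFun, Set.disjoint_left]
  rintro _ ⟨y, hy, rfl⟩ ⟨z, hz, h⟩
  apply hab
  simp only [one_div, inv_inj] at h
  have : (a:ℝ) < b + 1 := by linarith [hy.1, hz.2]
  have h1 : a < b + 1 := by exact_mod_cast this
  have : (b:ℝ) < a + 1 := by linarith [hz.1, hy.2]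
  have h2 : b < a + 1 := by exact_mod_cast this
  omega

lemma lintegral_gauss (g : ℝ → ENNReal) : ∫⁻ x, g x ∂gaussMeasure =
    ∫⁻ x in Ico (0:ℝ) 1, ENNReal.ofReal (1 / ((1 + x) * Real.log 2)) * g x := by
  unfold gaussMeasure
  rw [lintegral_withDensity_eq_lintegral_mul_non_measurable]
  · rfl
  · fun_prop
  · exact Eventually.of_forall fun x => ENNReal.ofReal_lt_top

lemma transfer_dual {f : ℝ → ℝ} {δ : ℝ} (h : MonOsc f δ) (hf : ∀ x ∈ Icc (0:ℝ) 1, 0 ≤ f x)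
    (g : ℝ → ENNReal) (hg : Measurable g) :
    ∫⁻ x, ENNReal.ofReal (f x) * g (gaussMap x) ∂gaussMeasure =
      ∫⁻ x, ENNReal.ofReal (transferOp f x) * g x ∂gaussMeasure := by
  have hl2 : 0 < Real.log 2 := Real.log_pos one_lt_two
  rw [lintegral_gauss, lintegral_gauss, setLIntegral_congr Ico_ae_eq_Ioc, ← branch_union]
  have hinj : ∀ k : ℕ, InjOn (fun y : ℝ => 1 / ((k:ℝ) + 1 + y)) (Ico 0 1) := by
    intro k a _ b _ hab
    simpa using hab
  have hder : ∀ k : ℕ, ∀ y ∈ Ico (0:ℝ) 1, HasDerivWithinAt (fun y : ℝ => 1 / ((k:ℝ) + 1 + y))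
      (-1 / ((k:ℝ) + 1 + y) ^ 2) (Ico 0 1) y := by
    intro k y hy
    have := hy.1
    have h1 : HasDerivAt (fun y : ℝ => (k:ℝ) + 1 + y) 1 y := (hasDerivAt_id y).const_add _
    have h2 := h1.inv (by positivity)
    simp only [one_div]
    exact h2.hasDerivWithinAt
  rw [lintegral_iUnion _ branch_disj]
  · have step : ∀ k : ℕ, ∫⁻ x in (fun y : ℝ => 1 / ((k:ℝ) + 1 + y)) '' Ico (0:ℝ) 1,
        ENNReal.ofReal (1 / ((1 + x) * Real.log 2)) * (ENNReal.ofReal (f x) * g (gaussMap x)) =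
        ∫⁻ y in Ico (0:ℝ) 1, ENNReal.ofReal (1 / ((1 + y) * Real.log 2)) *
          (ENNReal.ofReal (pkk k y * f (1 / ((k:ℝ) + 1 + y))) * g y) := by
      intro k
      rw [lintegral_image_eq_lintegral_abs_deriv_mul measurableSet_Ico (hder k) (hinj k)]
      refine setLIntegral_congr_fun measurableSet_Ico fun y hy => ?_
      have hy0 := hy.1
      simp only [gaussMap_branch k hy]
      rw [← mul_assoc, ← mul_assoc, ← mul_assoc, ← ENNReal.ofReal_mul (abs_nonneg _),
        ← ENNReal.ofReal_mul (by positivity), ← ENNReal.ofReal_mul (by positivity)]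
      congr 2
      rw [← mul_assoc]
      congr 1
      rw [abs_div, abs_neg, abs_one, abs_of_nonneg (by positivity)]
      unfold pkk
      have a1 : (k:ℝ) + 1 + y ≠ 0 := by positivity
      have a2 : (k:ℝ) + 2 + y ≠ 0 := by positivity
      have a3 : 1 + y ≠ 0 := by positivity
      have a4 : 1 + 1 / ((k:ℝ) + 1 + y) = ((k:ℝ) + 2 + y) / ((k:ℝ) + 1 + y) := by
        field_simp; ring
      rw [a4]
      field_simp
    simp_rw [step]
    rw [← lintegral_tsum]
    · refine setLIntegral_congr_fun measurableSet_Ico fun y hy => ?_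
      have hy' : y ∈ Icc (0:ℝ) 1 := ⟨hy.1, hy.2.le⟩
      rw [ENNReal.tsum_mul_left, ENNReal.tsum_mul_right, transferOp_eq,
        ENNReal.ofReal_tsum_of_nonneg]
      · exact fun k => mul_nonneg (pkk_nonneg k hy.1) (hf _ (branch_mem k hy'))
      · exact pkk_summable_mul hy.1 _ _ fun k => h.bdd (branch_mem k hy')
    · intro k
      have h1 := h.branch_aemeas k
      have h2 : Measurable (pkk k) := by unfold pkk; fun_prop
      have h3 : Measurable fun y : ℝ => ENNReal.ofReal (1 / ((1 + y) * Real.log 2)) := by fun_prop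
      exact h3.aemeasurable.mul ((h2.aemeasurable.mul h1).ennreal_ofReal.mul hg.aemeasurable)
  · intro k
    refine measurableSet_Ico.image_of_continuousOn_injOn (fun y hy => ?_) (hinj k)
    exact (hder k y hy).continuousWithinAt

lemma gauss_ae_mem : ∀ᵐ x ∂gaussMeasure, x ∈ Ico (0:ℝ) 1 := by
  unfold gaussMeasure
  refine (withDensity_absolutelyContinuous _ _).ae_le ?_
  exact ae_restrict_mem measurableSet_Ico

lemma mix_bounds (n : ℕ) : ∀ (f : ℝ → ℝ) (δ : ℝ), MonOsc f δ → (∀ x ∈ Icc (0:ℝ) 1, 0 ≤ f x) →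
    ∃ lo : ℝ, 0 ≤ lo ∧ ∀ E : Set ℝ, MeasurableSet E →
      ENNReal.ofReal lo * gaussMeasure E ≤
        ∫⁻ x, ENNReal.ofReal (f x) * E.indicator 1 (gaussMap^[n] x) ∂gaussMeasure ∧
      ∫⁻ x, ENNReal.ofReal (f x) * E.indicator 1 (gaussMap^[n] x) ∂gaussMeasure ≤
        ENNReal.ofReal (lo + δ / 2 ^ n) * gaussMeasure E := by
  induction n with
  | zero =>
    intro f δ h hf
    refine ⟨min (f 0) (f 1), le_min (hf 0 (by simp)) (hf 1 (by simp)), fun E hE => ?_⟩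
    have e : ∀ c : ENNReal, c * gaussMeasure E = ∫⁻ x, c * E.indicator 1 x ∂gaussMeasure := by
      intro c
      rw [lintegral_const_mul _ (measurable_one.indicator hE), lintegral_indicator_one hE]
    rw [e, e]
    simp only [Function.iterate_zero, id, pow_zero, div_one]
    constructor
    · refine lintegral_mono_ae ?_
      filter_upwards [gauss_ae_mem] with x hx
      gcongr
      exact (h.lohi ⟨hx.1, hx.2.le⟩).1
    · refine lintegral_mono_ae ?_
      filter_upwards [gauss_ae_mem] with x hx
      gcongr
      exact (h.lohi ⟨hx.1, hx.2.le⟩).2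
  | succ n ih =>
    intro f δ h hf
    obtain ⟨lo, h0, h1⟩ := ih (transferOp f) (δ / 2) h.transfer (transfer_nonneg hf)
    refine ⟨lo, h0, fun E hE => ?_⟩
    have := transfer_dual h hf (fun x => E.indicator 1 (gaussMap^[n] x))
      ((measurable_one.indicator hE).comp (measurable_gaussMap.iterate n))
    simp only [Function.iterate_succ, Function.comp]
    have e : δ / 2 ^ (n + 1) = δ / 2 / 2 ^ n := by rw [pow_succ, mul_comm, div_div]
    rw [this, e]
    exact h1 E hE

instance gauss_prob : IsProbabilityMeasure gaussMeasure := by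
  constructor
  have hl2 : 0 < Real.log 2 := Real.log_pos one_lt_two
  have h0 := lintegral_gauss (fun _ => 1)
  rw [lintegral_one] at h0
  rw [h0, setLIntegral_congr Ico_ae_eq_Ioc]
  simp only [mul_one]
  have hc : ContinuousOn (fun x : ℝ => 1 / ((1 + x) * Real.log 2)) (uIcc 0 1) := by
    refine continuousOn_const.div (by fun_prop) ?_
    intro x hx
    rw [uIcc_of_le zero_le_one] at hx
    have := hx.1
    positivity
  have hi : IntervalIntegrable (fun x : ℝ => 1 / ((1 + x) * Real.log 2)) volume 0 1 :=
    hc.intervalIntegrable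
  rw [← ofReal_integral_eq_lintegral_ofReal]
  · rw [← intervalIntegral.integral_of_le zero_le_one]
    rw [intervalIntegral.integral_eq_sub_of_hasDerivAt
      (f := fun x => Real.log (1 + x) / Real.log 2) _ hi]
    · norm_num
    · intro x hx
      rw [uIcc_of_le zero_le_one] at hx
      have := hx.1
      have h1 : HasDerivAt (fun y : ℝ => 1 + y) 1 x := (hasDerivAt_id x).const_add _
      have h2 := (h1.log (by positivity)).div_const (Real.log 2)
      rwa [div_div] at h2
  · exact (intervalIntegrable_iff_integrableOn_Ioc_of_le zero_le_one).1 hi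
  · refine (ae_restrict_mem measurableSet_Ioc).mono fun x hx => ?_
    have := hx.1
    simp only [Pi.zero_apply]
    positivity

lemma mix_Iio (a : ℝ) (E : Set ℝ) (hE : MeasurableSet E) :
    Tendsto (fun n : ℕ => gaussMeasure.real (Iio a ∩ gaussMap^[n] ⁻¹' E)) atTop
      (nhds (gaussMeasure.real (Iio a) * gaussMeasure.real E)) := by
  have hmon : MonOsc ((Iio a).indicator 1) 1 := by
    refine Or.inr ⟨?_, ?_⟩
    · intro x _ y _ hxy
      by_cases h : y < a
      · rw [indicator_of_mem (show y ∈ Iio a from h),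
          indicator_of_mem (show x ∈ Iio a from hxy.trans_lt h)]; simp
      · rw [indicator_of_notMem (show y ∉ Iio a from h)]
        exact indicator_nonneg (fun _ _ => zero_le_one) _
    · have h1 : (Iio a).indicator (1 : ℝ → ℝ) 0 ≤ 1 := indicator_le_self' (fun _ _ => zero_le_one) _
      have h2 : 0 ≤ (Iio a).indicator (1 : ℝ → ℝ) 1 := indicator_nonneg (fun _ _ => zero_le_one) _
      linarith
  have hnn : ∀ x ∈ Icc (0:ℝ) 1, 0 ≤ (Iio a).indicator (1 : ℝ → ℝ) x :=
    fun x _ => indicator_nonneg (fun _ _ => zero_le_one) _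
  have hmeas : ∀ n : ℕ, ∀ E : Set ℝ, MeasurableSet E → 
      ∫⁻ x, ENNReal.ofReal ((Iio a).indicator (1 : ℝ → ℝ) x) * E.indicator 1 (gaussMap^[n] x)
        ∂gaussMeasure = gaussMeasure (Iio a ∩ gaussMap^[n] ⁻¹' E) := by
    intro n E hE
    rw [← lintegral_indicator_one (measurableSet_Iio.inter (measurable_gaussMap.iterate n hE))]
    refine lintegral_congr fun x => ?_
    by_cases h1 : x ∈ Iio a <;> by_cases h2 : gaussMap^[n] x ∈ E <;>
      simp [indicator, h1, h2]
  have key : ∀ n : ℕ, |gaussMeasure.real (Iio a ∩ gaussMap^[n] ⁻¹' E) -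
      gaussMeasure.real (Iio a) * gaussMeasure.real E| ≤ (1 / 2) ^ n := by
    intro n
    obtain ⟨lo, h0, h⟩ := mix_bounds n _ _ hmon hnn
    have hr : ∀ E : Set ℝ, MeasurableSet E → lo * gaussMeasure.real E ≤
        gaussMeasure.real (Iio a ∩ gaussMap^[n] ⁻¹' E) ∧
        gaussMeasure.real (Iio a ∩ gaussMap^[n] ⁻¹' E) ≤
          (lo + 1 / 2 ^ n) * gaussMeasure.real E := by
      intro E hE
      have := h E hE
      rw [hmeas n E hE] at this
      constructor
      · have t := ENNReal.toReal_mono (measure_ne_top _ _) this.1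
        rwa [ENNReal.toReal_mul, ENNReal.toReal_ofReal h0] at t
      · have t := ENNReal.toReal_mono
          (ENNReal.mul_ne_top ENNReal.ofReal_ne_top (measure_ne_top _ _)) this.2
        rwa [ENNReal.toReal_mul, ENNReal.toReal_ofReal (by positivity)] at t
    have hu := hr univ MeasurableSet.univ
    have hE' := hr E hE
    simp only [preimage_univ, inter_univ, probReal_univ, mul_one] at hu
    have e1 : gaussMeasure.real E ≤ 1 := measureReal_le_one
    have e0 : 0 ≤ gaussMeasure.real E := measureReal_nonneg
    have ep : (0:ℝ) < 1 / 2 ^ n := by positivity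
    rw [one_div_pow, abs_le]
    constructor <;> nlinarith
  rw [tendsto_iff_dist_tendsto_zero]
  refine squeeze_zero (fun n => dist_nonneg) (fun n => ?_)
    (tendsto_pow_atTop_nhds_zero_of_lt_one (r := (1/2 : ℝ)) (by norm_num) (by norm_num))
  rw [Real.dist_eq]
  exact key n

lemma gauss_preserving (n : ℕ) (E : Set ℝ) (hE : MeasurableSet E) :
    gaussMeasure (gaussMap^[n] ⁻¹' E) = gaussMeasure E := by
  have hmon : MonOsc (fun _ => 1) 0 := Or.inl ⟨monotoneOn_const, by simp⟩
  obtain ⟨lo, h0, h⟩ := mix_bounds n _ _ hmon (fun _ _ => zero_le_one)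
  have hr : ∀ E : Set ℝ, MeasurableSet E → gaussMeasure (gaussMap^[n] ⁻¹' E) =
      ENNReal.ofReal lo * gaussMeasure E := by
    intro E hE
    have := h E hE
    simp only [ENNReal.ofReal_one, one_mul, zero_div, add_zero] at this
    have e : ∫⁻ x, E.indicator 1 (gaussMap^[n] x) ∂gaussMeasure =
        gaussMeasure (gaussMap^[n] ⁻¹' E) := by
      rw [← lintegral_indicator_one (measurable_gaussMap.iterate n hE)]
      rfl
    rw [e] at this
    exact le_antisymm this.2 this.1
  have hu := hr univ MeasurableSet.univ
  simp only [preimage_univ, measure_univ, mul_one] at hu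
  rw [hr E hE, ← hu, one_mul]

lemma hasSum_gauss_iUnion {f : ℕ → Set ℝ} (hd : Pairwise (Function.onFun Disjoint f))
    (hf : ∀ i, MeasurableSet (f i)) :
    HasSum (fun i => gaussMeasure.real (f i)) (gaussMeasure.real (⋃ i, f i)) := by
  have h := measure_iUnion (μ := gaussMeasure) hd hf
  have hne : ∑' i, gaussMeasure (f i) ≠ ⊤ := by rw [← h]; exact measure_ne_top _ _
  have h2 := ENNReal.hasSum_toReal hne
  rw [← ENNReal.tsum_toReal_eq (fun i => measure_ne_top _ _), ← h] at h2
  exact h2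

lemma mix_all (C : Set ℝ) (hC : MeasurableSet C) (E : Set ℝ) (hE : MeasurableSet E) :
    Tendsto (fun n : ℕ => gaussMeasure.real (C ∩ gaussMap^[n] ⁻¹' E)) atTop
      (nhds (gaussMeasure.real C * gaussMeasure.real E)) := by
  have hT : ∀ n, MeasurableSet (gaussMap^[n] ⁻¹' E) := fun n => measurable_gaussMap.iterate n hE
  induction C, hC using MeasurableSpace.induction_on_inter
    ((BorelSpace.measurable_eq (α := ℝ)).trans (borel_eq_generateFrom_Iio ℝ)) isPiSystem_Iio with
  | empty => simp
  | basic t ht =>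
    obtain ⟨a, rfl⟩ := ht
    exact mix_Iio a E hE
  | compl t ht ih =>
    have e : ∀ n : ℕ, gaussMeasure.real (tᶜ ∩ gaussMap^[n] ⁻¹' E) =
        gaussMeasure.real E - gaussMeasure.real (t ∩ gaussMap^[n] ⁻¹' E) := by
      intro n
      have h1 : gaussMeasure.real (gaussMap^[n] ⁻¹' E) = gaussMeasure.real E := by
        rw [measureReal_def, gauss_preserving n E hE, measureReal_def]
      have h2 := measureReal_inter_add_sdiff (μ := gaussMeasure) (s := gaussMap^[n] ⁻¹' E) ht
      rw [← h1, ← h2, inter_comm, inter_comm t, sdiff_eq]; ring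
    simp_rw [e]
    have e2 : gaussMeasure.real tᶜ * gaussMeasure.real E =
        gaussMeasure.real E - gaussMeasure.real t * gaussMeasure.real E := by
      rw [probReal_compl_eq_one_sub ht]; ring
    rw [e2]
    exact ih.const_sub _
  | iUnion f hd hf ih =>
    have hsum : HasSum (fun i => gaussMeasure.real (f i)) (gaussMeasure.real (⋃ i, f i)) :=
      hasSum_gauss_iUnion hd hf
    have e : ∀ n : ℕ, gaussMeasure.real ((⋃ i, f i) ∩ gaussMap^[n] ⁻¹' E) =
        ∑' i, gaussMeasure.real (f i ∩ gaussMap^[n] ⁻¹' E) := by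
      intro n
      rw [iUnion_inter]
      refine (hasSum_gauss_iUnion ?_ (fun i => (hf i).inter (hT n))).tsum_eq.symm
      intro i j hij
      exact (hd hij).mono inter_subset_left inter_subset_left
    simp_rw [e]
    rw [← (hsum.mul_right _).tsum_eq]
    refine tendsto_tsum_of_dominated_convergence hsum.summable ih (Eventually.of_forall ?_)
    intro n i
    rw [Real.norm_of_nonneg measureReal_nonneg]
    exact measureReal_mono inter_subset_left

/-- Irrational points of the unit interval. -/
def irrUnit : Set ℝ := {y | y ∈ Ico (0:ℝ) 1 ∧ Irrational y}

lemma irr_gaussMap {y : ℝ} (hy : y ∈ irrUnit) : gaussMap y ∈ irrUnit := by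
  unfold gaussMap
  refine ⟨⟨Int.fract_nonneg _, Int.fract_lt_one _⟩, ?_⟩
  rw [Int.fract]
  exact hy.2.inv.sub_intCast _

lemma irr_iterate {y : ℝ} (hy : y ∈ irrUnit) (n : ℕ) : gaussMap^[n] y ∈ irrUnit := by
  induction n with
  | zero => exact hy
  | succ n ih => rw [Function.iterate_succ_apply']; exact irr_gaussMap ih

lemma cfDigit_pos {y : ℝ} (hy : y ∈ irrUnit) (n : ℕ) : 1 ≤ cfDigit y n := by
  have h := irr_iterate hy n
  unfold cfDigit
  rw [Int.le_floor]
  have h0 : 0 < gaussMap^[n] y := lt_of_le_of_ne h.1.1 h.2.ne_zero.symm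
  simpa using (one_le_inv₀ h0).2 h.1.2.le

lemma half_iff {y : ℝ} (hy : y ∈ irrUnit) (n : ℕ) :
    gaussMap^[n] y ∈ Ico (1/2 : ℝ) 1 ↔ cfDigit y n = 1 := by
  have h := irr_iterate hy n
  unfold cfDigit
  set z := gaussMap^[n] y
  have h0 : 0 < z := lt_of_le_of_ne h.1.1 h.2.ne_zero.symm
  rw [Int.floor_eq_iff]
  constructor
  · rintro ⟨h1, h2⟩
    refine ⟨by simpa using (one_le_inv₀ h0).2 h2.le, ?_⟩
    have h3 : 1 / 2 < z := lt_of_le_of_ne h1 (by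
      intro h4
      refine h.2 ⟨1 / 2, ?_⟩
      rw [← h4]; norm_num)
    rw [inv_lt_comm₀ h0 (by norm_num)]
    norm_num at h3 ⊢
    exact h3
  · rintro ⟨_, h2⟩
    refine ⟨?_, h.1.2⟩
    rw [inv_lt_comm₀ h0 (by norm_num)] at h2
    norm_num at h2 ⊢
    exact h2.le

lemma cfDigit_iterate (y : ℝ) (d i : ℕ) : cfDigit (gaussMap^[d] y) i = cfDigit y (i + d) := by
  unfold cfDigit
  rw [Function.iterate_add_apply]

lemma gauss_ae_irr : ∀ᵐ y ∂gaussMeasure, y ∈ irrUnit := by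
  have h : ∀ᵐ y ∂gaussMeasure, y ∉ range ((↑) : ℚ → ℝ) := by
    have ac : gaussMeasure ≪ volume :=
      (withDensity_absolutelyContinuous _ _).trans Measure.absolutelyContinuous_restrict
    refine ac.ae_le ?_
    exact (countable_range _).ae_notMem _
  filter_upwards [gauss_ae_mem, h] with y h1 h2
  exact ⟨h1, h2⟩

lemma exists_word {y : ℝ} (hy : y ∈ irrUnit) (M : ℕ) :
    ∃ s : List ℕ+, s.length = M ∧ y ∈ cylinder s := by
  refine ⟨List.ofFn fun i : Fin M => (cfDigit y i).toNat.toPNat', by simp, hy.1, ?_⟩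
  intro i h
  have := cfDigit_pos hy i
  simp only [List.get_eq_getElem, List.getElem_ofFn]
  rw [Nat.toPNat'_coe, if_pos (by omega)]
  omega

lemma measurable_cfDigit (n : ℕ) : Measurable (fun y => cfDigit y n) := by
  unfold cfDigit
  exact (measurable_gaussMap.iterate n).inv.floor

/-- Membership depends only on the first `M` digits. -/
def DigitDet (M : ℕ) (D : Set ℝ) : Prop :=
  ∀ y ∈ irrUnit, ∀ z ∈ irrUnit, (∀ i < M, cfDigit y i = cfDigit z i) → y ∈ D → z ∈ D

lemma DigitDet.compl {M : ℕ} {D : Set ℝ} (h : DigitDet M D) : DigitDet M Dᶜ :=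
  fun y hy z hz hyz hyD hzD => hyD (h z hz y hy (fun i hi => (hyz i hi).symm) hzD)

lemma card_eq_sum (p : ℕ → ℝ) (D : Set ℝ) (n : ℕ) :
    (Nat.card {i : ℕ | i ≤ n ∧ p i ∈ D} : ℝ) =
      ∑ i ∈ Finset.range (n + 1), D.indicator (1 : ℝ → ℝ) (p i) := by
  classical
  have : {i : ℕ | i ≤ n ∧ p i ∈ D} = ↑((Finset.range (n + 1)).filter fun i => p i ∈ D) := by
    ext i; simp
  rw [this, Nat.card_coe_set_eq, Set.ncard_coe_finset]
  simp [indicator]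

lemma ind_abs (D : Set ℝ) (y : ℝ) : |D.indicator (1 : ℝ → ℝ) y| ≤ 1 := by
  by_cases h : y ∈ D <;> simp [h]

lemma normal_avg {x : ℝ} (hnorm : CFNormal x) (s : List ℕ+) (hs : s ≠ []) :
    Tendsto (fun N : ℕ => (∑ i ∈ Finset.range N,
      (cylinder s).indicator (1 : ℝ → ℝ) (gaussMap^[i] x)) / N) atTop
      (nhds (gaussMeasure.real (cylinder s))) := by
  rw [← avg_succ _ 1 (fun i => ind_abs _ _)]
  have := hnorm s hs
  simp_rw [card_eq_sum] at this
  exact this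

lemma det_lower {x : ℝ} (hx : x ∈ irrUnit) (hnorm : CFNormal x) {M : ℕ} (hM : 1 ≤ M)
    {D : Set ℝ} (hD : DigitDet M D) (ε : ℝ) (hε : 0 < ε) :
    ∀ᶠ N : ℕ in atTop, gaussMeasure.real D - ε <
      (∑ i ∈ Finset.range N, D.indicator (1 : ℝ → ℝ) (gaussMap^[i] x)) / N := by
  have hnn : ∀ y, 0 ≤ D.indicator (1 : ℝ → ℝ) y :=
    fun y => indicator_nonneg (fun _ _ => zero_le_one) _
  rcases lt_or_ge (gaussMeasure.real D - ε) 0 with hneg | hpos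
  · refine Eventually.of_forall fun N => hneg.trans_le ?_
    exact div_nonneg (Finset.sum_nonneg fun i _ => hnn _) (Nat.cast_nonneg _)
  set S := {s : List ℕ+ // s.length = M ∧ ∃ y ∈ irrUnit, y ∈ cylinder s ∧ y ∈ D}
  have hcov : gaussMeasure D ≤ ∑' s : S, gaussMeasure (cylinder s.1) := by
    refine le_trans (measure_mono_ae ?_) (measure_iUnion_le _)
    filter_upwards [gauss_ae_irr] with y hy hyD
    obtain ⟨s, h1, h2⟩ := exists_word hy M
    exact mem_iUnion.2 ⟨⟨s, h1, y, hy, h2, hyD⟩, h2⟩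
  have hlt : ENNReal.ofReal (gaussMeasure.real D - ε) < ∑' s : S, gaussMeasure (cylinder s.1) := by
    refine lt_of_lt_of_le ?_ hcov
    rw [ENNReal.ofReal_lt_iff_lt_toReal hpos (measure_ne_top _ _)]
    change _ < gaussMeasure.real D
    linarith
  rw [ENNReal.tsum_eq_iSup_sum, lt_iSup_iff] at hlt
  obtain ⟨F, hF⟩ := hlt
  rw [ENNReal.ofReal_lt_iff_lt_toReal hpos (by simp [ENNReal.sum_eq_top]),
    ENNReal.toReal_sum (fun _ _ => measure_ne_top _ _)] at hF
  have hlim : Tendsto (fun N : ℕ => ∑ s ∈ F, (∑ i ∈ Finset.range N,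
      (cylinder s.1).indicator (1 : ℝ → ℝ) (gaussMap^[i] x)) / N) atTop
      (nhds (∑ s ∈ F, gaussMeasure.real (cylinder s.1))) := by
    refine tendsto_finsetSum _ fun s _ => normal_avg hnorm _ ?_
    intro h
    have := s.2.1
    rw [h] at this
    simp at this
    omega
  filter_upwards [hlim.eventually (lt_mem_nhds hF)] with N hN
  refine hN.trans_le ?_
  rw [← Finset.sum_div, Finset.sum_comm]
  gcongr with i hi
  have hy := irr_iterate hx i
  set y := gaussMap^[i] x
  by_cases hex : ∃ s ∈ F, y ∈ cylinder s.1
  · obtain ⟨s, hs, hys⟩ := hex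
    obtain ⟨z, hz, hzs, hzD⟩ := s.2.2
    have hyD : y ∈ D := by
      refine hD z hz y hy (fun i hi => ?_) hzD
      rw [hzs.2 i (by rw [s.2.1]; exact hi), hys.2 i (by rw [s.2.1]; exact hi)]
    rw [Finset.sum_eq_single s]
    · rw [indicator_of_mem hys, indicator_of_mem hyD]
    · intro t ht hts
      refine indicator_of_notMem (fun hyt => hts ?_) _
      refine Subtype.ext (List.ext_getElem (by rw [t.2.1, s.2.1]) fun i h1 h2 => ?_)
      have a := hyt.2 i h1
      have b := hys.2 i h2
      rw [a] at b
      simp only [List.get_eq_getElem] at b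
      exact PNat.coe_injective (by exact_mod_cast b)
    · exact fun h => absurd hs h
  · push Not at hex
    rw [Finset.sum_eq_zero fun s hs => indicator_of_notMem (hex s hs) _]
    exact hnn _

lemma det_avg {x : ℝ} (hx : x ∈ irrUnit) (hnorm : CFNormal x) {M : ℕ} (hM : 1 ≤ M)
    {D : Set ℝ} (hDm : MeasurableSet D) (hD : DigitDet M D) :
    Tendsto (fun N : ℕ => (∑ i ∈ Finset.range N, D.indicator (1 : ℝ → ℝ) (gaussMap^[i] x)) / N)
      atTop (nhds (gaussMeasure.real D)) := by
  rw [tendsto_order]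
  constructor
  · intro a ha
    filter_upwards [det_lower hx hnorm hM hD (gaussMeasure.real D - a) (by linarith)] with N hN
    linarith
  · intro a ha
    filter_upwards [det_lower hx hnorm hM hD.compl (a - gaussMeasure.real D) (by linarith),
      eventually_ge_atTop 1] with N hN hN1
    rw [probReal_compl_eq_one_sub hDm] at hN
    have hNp : (0:ℝ) < N := by exact_mod_cast hN1
    have e : (∑ i ∈ Finset.range N, Dᶜ.indicator (1 : ℝ → ℝ) (gaussMap^[i] x)) / N = 
        1 - (∑ i ∈ Finset.range N, D.indicator (1 : ℝ → ℝ) (gaussMap^[i] x)) / N := by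
      have : ∀ y, Dᶜ.indicator (1 : ℝ → ℝ) y = 1 - D.indicator (1 : ℝ → ℝ) y := by
        intro y
        by_cases h : y ∈ D <;> simp [h]
      simp_rw [this, Finset.sum_sub_distrib]
      rw [sub_div]
      simp [hNp.ne']
    rw [e] at hN
    linarith

theorem sampled_frequency (x : ℝ) (hx : x ∈ Set.Ico (0:ℝ) 1) (hirr : Irrational x)
    (hnorm : CFNormal x) (m k : ℕ) (hm : 1 ≤ m) (hk1 : 1 ≤ k) (hkm : k ≤ m) :
    Filter.Tendsto
      (fun n : ℕ => (Nat.card {i : ℕ | i ≤ n ∧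
        gaussMap^[m * i + k - 1] x ∈
          Set.Ico (1/2 : ℝ) 1 ∩ gaussMap^[m] ⁻¹' Set.Ico (1/2 : ℝ) 1} : ℝ) / n)
      Filter.atTop
      (nhds (gaussMeasure
        (Set.Ico (1/2 : ℝ) 1 ∩ gaussMap^[m] ⁻¹' Set.Ico (1/2 : ℝ) 1)).toReal) := by
  have hx' : x ∈ irrUnit := ⟨hx, hirr⟩
  set B : Set ℝ := Set.Ico (1/2 : ℝ) 1 ∩ gaussMap^[m] ⁻¹' Set.Ico (1/2 : ℝ) 1 with hB
  have hBm : MeasurableSet B :=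
    measurableSet_Ico.inter (measurable_gaussMap.iterate m measurableSet_Ico)
  have hBiff : ∀ y ∈ irrUnit, (y ∈ B ↔ cfDigit y 0 = 1 ∧ cfDigit y m = 1) := by
    intro y hy
    rw [← half_iff hy 0, ← half_iff hy m]
    rfl
  have hBdiff : ∀ d, ∀ y ∈ irrUnit,
      (y ∈ B ∩ gaussMap^[d] ⁻¹' B ↔ (cfDigit y 0 = 1 ∧ cfDigit y m = 1) ∧
        (cfDigit y d = 1 ∧ cfDigit y (m + d) = 1)) := by
    intro d y hy
    rw [mem_inter_iff, mem_preimage, hBiff y hy, hBiff _ (irr_iterate hy d), cfDigit_iterate,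
      cfDigit_iterate, zero_add]
  have hdet : DigitDet (m + 1) B := by
    intro y hy z hz h hyB
    rw [hBiff y hy] at hyB
    rw [hBiff z hz, ← h 0 (by omega), ← h m (by omega)]
    exact hyB
  have hdetd : ∀ d, DigitDet (m + d + 1) (B ∩ gaussMap^[d] ⁻¹' B) := by
    intro d y hy z hz h hyB
    rw [hBdiff d y hy] at hyB
    rw [hBdiff d z hz, ← h 0 (by omega), ← h m (by omega), ← h d (by omega),
      ← h (m + d) (by omega)]
    exact hyB
  set b := gaussMeasure.real B with hb
  have hb0 : 0 ≤ b := measureReal_nonneg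
  have hb1 : b ≤ 1 := measureReal_le_one
  set u : ℕ → ℝ := fun i => B.indicator (1 : ℝ → ℝ) (gaussMap^[i] x) with hu
  have hu01 : ∀ i, 0 ≤ u i ∧ u i ≤ 1 := by
    intro i
    by_cases h : gaussMap^[i] x ∈ B <;> simp [hu, h]
  have huabs : ∀ i, |u i| ≤ 1 := fun i => ind_abs _ _
  have hav : Tendsto (fun N : ℕ => (∑ i ∈ Finset.range N, u i) / N) atTop (nhds b) :=
    det_avg hx' hnorm (by omega) hBm hdet
  have havd : ∀ d, Tendsto (fun N : ℕ => (∑ i ∈ Finset.range N, u i * u (i + d)) / N) atTop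
      (nhds (gaussMeasure.real (B ∩ gaussMap^[d] ⁻¹' B))) := by
    intro d
    have h := det_avg hx' hnorm (by omega)
      (hBm.inter (measurable_gaussMap.iterate d hBm)) (hdetd d)
    refine h.congr fun N => ?_
    congr 1
    refine Finset.sum_congr rfl fun i _ => ?_
    simp only [hu]
    rw [add_comm i d, Function.iterate_add_apply]
    by_cases h1 : gaussMap^[i] x ∈ B <;> by_cases h2 : gaussMap^[d] (gaussMap^[i] x) ∈ B <;>
      simp [indicator, h1, h2]
  have hkey := seq_key (fun i => u i - b)
    (fun i => by have := hu01 i; rw [abs_le]; constructor <;> linarith)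
    (fun d => gaussMeasure.real (B ∩ gaussMap^[d] ⁻¹' B) - b * b)
    (fun d => by
      have h1 := havd d
      have h2 := avg_shift u 1 huabs d b hav
      have h3 := ((h1.sub (hav.const_mul b)).sub (h2.const_mul b)).add_const (b * b)
      have e : gaussMeasure.real (B ∩ gaussMap^[d] ⁻¹' B) - b * b - b * b + b * b =
        gaussMeasure.real (B ∩ gaussMap^[d] ⁻¹' B) - b * b := by ring
      rw [e] at h3
      refine h3.congr' ?_
      filter_upwards [eventually_ge_atTop 1] with N hN
      have hNp : (N:ℝ) ≠ 0 := by positivity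
      have e2 : ∑ i ∈ Finset.range N, (u i - b) * (u (i + d) - b) =
          ∑ i ∈ Finset.range N, u i * u (i + d) - b * ∑ i ∈ Finset.range N, u i -
            b * ∑ i ∈ Finset.range N, u (i + d) + N * (b * b) := by
        rw [Finset.mul_sum, Finset.mul_sum, ← Finset.sum_sub_distrib, ← Finset.sum_sub_distrib]
        have : (N:ℝ) * (b * b) = ∑ i ∈ Finset.range N, b * b := by simp
        rw [this, ← Finset.sum_add_distrib]
        exact Finset.sum_congr rfl fun i _ => by ring
      rw [e2]
      field_simp)
    (by
      have h := (mix_all B hBm B hBm).sub_const (b * b)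
      rwa [← hb, sub_self] at h) m (k - 1) hm
  have hfin : Tendsto (fun N : ℕ => (∑ i ∈ Finset.range N, u (m * i + (k - 1))) / N) atTop
      (nhds b) := by
    have h3 := hkey.add_const b
    rw [zero_add] at h3
    refine h3.congr' ?_
    filter_upwards [eventually_ge_atTop 1] with N hN
    have hNp : (N:ℝ) ≠ 0 := by positivity
    rw [Finset.sum_sub_distrib]
    simp only [Finset.sum_const, Finset.card_range, nsmul_eq_mul]
    field_simp
    ring
  rw [← avg_succ _ 1 (fun i => huabs _)] at hfin
  refine hfin.congr fun N => ?_
  have hk : ∀ i, m * i + k - 1 = m * i + (k - 1) := fun i => by omega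
  simp only [hk]
  rw [card_eq_sum (fun i => gaussMap^[m * i + (k - 1)] x) B N]
end
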